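/- arXiv:1805.02625 — 2 statements merged into one kernel-verified Lean document; each statement's English description precedes it below -/
import Mathlib

section
/- Polygamy of Δ_P for pure states: if the n-partite state |φ⟩_{A₁⋯A_{n−1}BC} is pure, then Δ_P(A₁:⋯:A_{n−1}:BC) ≤ Δ_P(A₁:⋯:A_{n−1}:B) + Δ_P(A₁:⋯:A_{n−1}:C). -/
open scoped BigOperators ComplexOrder

noncomputable section

/-- Von Neumann entropy of a matrix: `−∑ λᵢ log λᵢ` over its eigenvalues
(defined to be `0` if the matrix is not Hermitian). -/
noncomputable def matEntropy {ι : Type} [Fintype ι] [DecidableEq ι]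
    (ρ : Matrix ι ι ℂ) : ℝ :=
  if h : ρ.IsHermitian then ∑ i, Real.negMulLog (h.eigenvalues i) else 0

/-- A density matrix: positive semidefinite with unit trace. -/
def IsDensityMatrix {ι : Type} [Fintype ι] (ρ : Matrix ι ι ℂ) : Prop :=
  ρ.PosSemidef ∧ ρ.trace = 1

instance sumElimFintype {κ π : Type} {α : κ → Type} {δ : π → Type}
    [∀ i, Fintype (α i)] [∀ k, Fintype (δ k)] :
    ∀ i : κ ⊕ π, Fintype (Sum.elim α δ i)
  | .inl a => inferInstanceAs (Fintype (α a))
  | .inr b => inferInstanceAs (Fintype (δ b))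

instance sumElimDecEq {κ π : Type} {α : κ → Type} {δ : π → Type}
    [∀ i, DecidableEq (α i)] [∀ k, DecidableEq (δ k)] :
    ∀ i : κ ⊕ π, DecidableEq (Sum.elim α δ i)
  | .inl a => inferInstanceAs (DecidableEq (α a))
  | .inr b => inferInstanceAs (DecidableEq (δ b))

/-- Reduced density matrix on the subsystems in `s` (partial trace over the rest). -/
noncomputable def reduce {κ : Type} [Fintype κ] [DecidableEq κ] {α : κ → Type}
    [∀ i, Fintype (α i)] (s : Finset κ)
    (ρ : Matrix (∀ i, α i) (∀ i, α i) ℂ) :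
    Matrix (∀ i : {j // j ∈ s}, α i.1) (∀ i : {j // j ∈ s}, α i.1) ℂ :=
  Matrix.of fun f g => ∑ h : ∀ i : {j // j ∉ s}, α i.1,
    ρ (fun i => if hi : i ∈ s then f ⟨i, hi⟩ else h ⟨i, hi⟩)
      (fun i => if hi : i ∈ s then g ⟨i, hi⟩ else h ⟨i, hi⟩)

/-- The (pure) density matrix `|ψ⟩⟨ψ|` of a state vector. -/
def vecState {ι : Type} (ψ : ι → ℂ) : Matrix ι ι ℂ :=
  Matrix.of fun x y => ψ x * star (ψ y)

/-- Multipartite mutual information `∑ᵢ S_{Aᵢ} − S_{A₁⋯Aₙ}`. -/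
noncomputable def Imulti {κ : Type} [Fintype κ] [DecidableEq κ] {α : κ → Type}
    [∀ i, Fintype (α i)] [∀ i, DecidableEq (α i)]
    (ρ : Matrix (∀ i, α i) (∀ i, α i) ℂ) : ℝ :=
  (∑ i, matEntropy (reduce {i} ρ)) - matEntropy ρ

/-- Merge an assignment on the original systems with one on the ancillas. -/
def mergeSum {κ π : Type} {α : κ → Type} {δ : π → Type}
    (f : ∀ i, α i) (h : ∀ k, δ k) : ∀ i : κ ⊕ π, Sum.elim α δ i
  | .inl a => f a
  | .inr b => h b

/-- The subsystems belonging to party `k` together with its ancilla. -/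
def partyFinset {κ π : Type} [Fintype κ] [DecidableEq κ] [DecidableEq π]
    (p : κ → π) (k : π) : Finset (κ ⊕ π) :=
  (Finset.univ.filter fun i => p i = k).image Sum.inl ∪ {Sum.inr k}

/-- `ψ` (on the original systems plus one ancilla `Fin (d k)` per party)
purifies `ρ`: tracing out all ancillas from `|ψ⟩⟨ψ|` gives back `ρ`. -/
def Purifies {κ π : Type} [Fintype κ] {α : κ → Type} [∀ i, Fintype (α i)]
    [Fintype π] [DecidableEq π] {d : π → ℕ}
    (ψ : (∀ i : κ ⊕ π, Sum.elim α (fun k => Fin (d k)) i) → ℂ)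
    (ρ : Matrix (∀ i, α i) (∀ i, α i) ℂ) : Prop :=
  ∀ f g, (∑ h : ∀ k, Fin (d k), vecState ψ (mergeSum f h) (mergeSum g h)) = ρ f g

/-- Multipartite entanglement of purification for the partition of the systems `κ`
into parties `π` given by `p`: the infimum over all purifications (with one ancilla
per party, of arbitrary finite dimension) of `∑ₖ S_{AₖAₖ'}`. -/
noncomputable def DeltaPart {κ π : Type} [Fintype κ] [DecidableEq κ]
    [Fintype π] [DecidableEq π] {α : κ → Type}
    [∀ i, Fintype (α i)] [∀ i, DecidableEq (α i)]
    (p : κ → π) (ρ : Matrix (∀ i, α i) (∀ i, α i) ℂ) : ℝ :=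
  sInf { x | ∃ (d : π → ℕ) (ψ : (∀ i : κ ⊕ π, Sum.elim α (fun k => Fin (d k)) i) → ℂ),
    Purifies ψ ρ ∧
    x = ∑ k : π, matEntropy (reduce (partyFinset p k) (vecState ψ)) }

/-- Bipartite-style entanglement of purification for the partition `p`:
the infimum over purifications of the entropy of the single party `k₀`
together with its ancilla. -/
noncomputable def EPart {κ π : Type} [Fintype κ] [DecidableEq κ]
    [Fintype π] [DecidableEq π] {α : κ → Type}
    [∀ i, Fintype (α i)] [∀ i, DecidableEq (α i)]
    (p : κ → π) (k₀ : π) (ρ : Matrix (∀ i, α i) (∀ i, α i) ℂ) : ℝ :=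
  sInf { x | ∃ (d : π → ℕ) (ψ : (∀ i : κ ⊕ π, Sum.elim α (fun k => Fin (d k)) i) → ℂ),
    Purifies ψ ρ ∧
    x = matEntropy (reduce (partyFinset p k₀) (vecState ψ)) }

/-- The sum of `-λ log λ` over the real parts `λ` of the roots of the characteristic polynomial. -/
def charpolyEntropy {I : Type} [Fintype I] [DecidableEq I] (M : Matrix I I ℂ) : ℝ :=
  (M.charpoly.roots.map fun z => Real.negMulLog z.re).sum

theorem matEntropy_eq_charpolyEntropy {I : Type} [Fintype I] [DecidableEq I]
    {ρ : Matrix I I ℂ} (h : ρ.IsHermitian) : matEntropy ρ = charpolyEntropy ρ := by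
  rw [matEntropy, dif_pos h, charpolyEntropy, h.roots_charpoly_eq_eigenvalues, Multiset.map_map]
  rfl

theorem charpolyEntropy_mul_comm {I J : Type} [Fintype I] [DecidableEq I] [Fintype J]
    [DecidableEq J] (A : Matrix I J ℂ) (B : Matrix J I ℂ) :
    charpolyEntropy (A * B) = charpolyEntropy (B * A) := by
  have key (n : ℕ) (p : Polynomial ℂ) (hp : p.Monic) :
      ((Polynomial.X ^ n * p).roots.map fun z : ℂ => Real.negMulLog z.re).sum
        = (p.roots.map fun z : ℂ => Real.negMulLog z.re).sum := by
    rw [Polynomial.roots_mul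
      (mul_ne_zero (pow_ne_zero _ Polynomial.X_ne_zero) hp.ne_zero)]
    simp [Multiset.nsmul_singleton]
  rw [charpolyEntropy, charpolyEntropy, ← key (Fintype.card J) _ (Matrix.charpoly_monic _),
    Matrix.charpoly_mul_comm', key _ _ (Matrix.charpoly_monic _)]

theorem charpolyEntropy_transpose {I : Type} [Fintype I] [DecidableEq I] (M : Matrix I I ℂ) :
    charpolyEntropy M.transpose = charpolyEntropy M := by
  rw [charpolyEntropy, charpolyEntropy, Matrix.charpoly_transpose]

/-- The marginal of `ρ` along `f`, where the discarded degrees of freedom are recorded by `g`. -/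
def marg {I X Y : Type} [Fintype I] [DecidableEq X] [DecidableEq Y] (f : I → X) (g : I → Y)
    (ρ : Matrix I I ℂ) : Matrix X X ℂ :=
  Matrix.of fun x x' => ∑ i, ∑ j, if f i = x ∧ f j = x' ∧ g i = g j then ρ i j else 0

section marg

variable {I X Y : Type} [Fintype I] [DecidableEq X] [DecidableEq Y]

theorem marg_eq_sum [Fintype Y] (f : I → X) (g : I → Y) (ρ : Matrix I I ℂ) :
    marg f g ρ = ∑ y, (Matrix.of fun x i => if f i = x ∧ g i = y then (1 : ℂ) else 0) * ρ *
      (Matrix.of fun x i => if f i = x ∧ g i = y then (1 : ℂ) else 0).conjTranspose := by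
  ext x x'
  simp only [marg, Matrix.of_apply, Matrix.sum_apply, Matrix.mul_apply,
    Matrix.conjTranspose_apply, Finset.sum_mul]
  rw [Finset.sum_comm, Finset.sum_comm (s := (Finset.univ : Finset Y))]
  refine Finset.sum_congr rfl fun j _ => ?_
  rw [Finset.sum_comm]
  refine Finset.sum_congr rfl fun i _ => ?_
  rw [Finset.sum_eq_single (g i)]
  · simp only [@eq_comm _ (g j)]
    by_cases h1 : f i = x <;> by_cases h2 : f j = x' <;> by_cases h3 : g i = g j <;>
      simp [h1, h2, h3]
  · intro y _ hy
    simp [hy.symm]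
  · simp

theorem marg_posSemidef [Fintype X] [Fintype Y] (f : I → X) (g : I → Y) {ρ : Matrix I I ℂ}
    (h : ρ.PosSemidef) : (marg f g ρ).PosSemidef := by
  rw [marg_eq_sum]
  exact Matrix.posSemidef_sum _ fun y _ => h.mul_mul_conjTranspose_same _

theorem trace_marg_mul [Fintype X] (f : I → X) (g : I → Y) (ρ : Matrix I I ℂ)
    (Z : Matrix X X ℂ) :
    (marg f g ρ * Z).trace
      = (ρ * Matrix.of fun i j => if g i = g j then Z (f i) (f j) else 0).trace := by
  simp only [Matrix.trace, Matrix.diag, Matrix.mul_apply, marg, Matrix.of_apply, Finset.sum_mul]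
  have e (x x' : X) : ∑ i, ∑ j, (if f i = x ∧ f j = x' ∧ g i = g j then ρ i j else 0) * Z x' x
      = ∑ i, ∑ j, if f i = x then (if f j = x' then
        (if g i = g j then ρ i j * Z x' x else 0) else 0) else 0 := by
    refine Finset.sum_congr rfl fun i _ => Finset.sum_congr rfl fun j _ => ?_
    by_cases h1 : f i = x <;> by_cases h2 : f j = x' <;> by_cases h3 : g i = g j <;>
      simp [h1, h2, h3]
  have swap (F : X → X → I → I → ℂ) :
      ∑ x, ∑ x', ∑ i, ∑ j, F x x' i j = ∑ i, ∑ j, ∑ x, ∑ x', F x x' i j := by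
    calc _ = ∑ x, ∑ i, ∑ j, ∑ x', F x x' i j := by
          refine Finset.sum_congr rfl fun x _ => ?_
          rw [Finset.sum_comm]
          exact Finset.sum_congr rfl fun i _ => Finset.sum_comm
      _ = _ := by
          rw [Finset.sum_comm]
          exact Finset.sum_congr rfl fun i _ => Finset.sum_comm
  simp_rw [e]
  rw [swap]
  refine Finset.sum_congr rfl fun i _ => Finset.sum_congr rfl fun j _ => ?_
  rw [Finset.sum_eq_single (f i) (by intro x _ hx; simp [hx.symm]) (by simp),
    Finset.sum_eq_single (f j) (by intro x _ hx; simp [hx.symm]) (by simp)]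
  by_cases h : g i = g j
  · simp [h]
  · simp [h, Ne.symm h]

theorem trace_marg [DecidableEq I] [Fintype X] (f : I → X) (g : I → Y)
    (hfg : ∀ i j, f i = f j → g i = g j → i = j) (ρ : Matrix I I ℂ) :
    (marg f g ρ).trace = ρ.trace := by
  have h := trace_marg_mul f g ρ 1
  rw [mul_one] at h
  rw [h]
  congr 1
  conv_rhs => rw [← mul_one ρ]
  congr 1
  ext i j
  by_cases h1 : i = j
  · subst h1
    simp
  · by_cases h2 : g i = g j
    · have h3 : f i ≠ f j := fun h => h1 (hfg i j h h2)
      simp [h1, h2, h3]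
    · simp [h1, h2]

theorem charpolyEntropy_marg [DecidableEq I] [Fintype X] (f : I → X) (g : I → Y)
    (ρ : Matrix I I ℂ) :
    charpolyEntropy (marg f g ρ) = charpolyEntropy
      ((Matrix.of fun i j => if f i = f j then (1 : ℂ) else 0) *
        (Matrix.of fun i j => if g i = g j then ρ i j else 0)) := by
  set P : Matrix X I ℂ := Matrix.of fun x i => if f i = x then (1 : ℂ) else 0
  set N : Matrix I I ℂ := Matrix.of fun i j => if g i = g j then ρ i j else 0
  have h1 : marg f g ρ = P * N * P.transpose := by
    ext x x'
    simp only [marg, Matrix.of_apply, Matrix.mul_apply, Matrix.transpose_apply, P, N,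
      Finset.sum_mul]
    rw [Finset.sum_comm]
    refine Finset.sum_congr rfl fun j _ => Finset.sum_congr rfl fun i _ => ?_
    by_cases h1 : f i = x <;> by_cases h2 : f j = x' <;> by_cases h3 : g i = g j <;>
      simp [h1, h2, h3]
  have h2 : (Matrix.of fun i j => if f i = f j then (1 : ℂ) else 0) = P.transpose * P := by
    ext i j
    simp [P, Matrix.mul_apply, Matrix.transpose_apply, eq_comm]
  rw [h1, h2, charpolyEntropy_mul_comm, Matrix.mul_assoc]

/-- The entropy of a marginal depends only on which points the two maps identify. -/
theorem matEntropy_marg_congr {X' Y' : Type} [DecidableEq X'] [DecidableEq Y'] [DecidableEq I]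
    [Fintype X] [Fintype X'] [Fintype Y] [Fintype Y'] {f : I → X} {f' : I → X'} {g : I → Y}
    {g' : I → Y'} (hf : ∀ i j, f i = f j ↔ f' i = f' j) (hg : ∀ i j, g i = g j ↔ g' i = g' j)
    {ρ : Matrix I I ℂ} (hρ : ρ.PosSemidef) :
    matEntropy (marg f g ρ) = matEntropy (marg f' g' ρ) := by
  rw [matEntropy_eq_charpolyEntropy (marg_posSemidef f g hρ).1,
    matEntropy_eq_charpolyEntropy (marg_posSemidef f' g' hρ).1, charpolyEntropy_marg,
    charpolyEntropy_marg]
  simp_rw [hf, hg]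

theorem marg_marg {X' Y' : Type} [DecidableEq X'] [DecidableEq Y'] [Fintype X] (f : I → X)
    (g : I → Y) (f' : X → X') (g' : X → Y') (ρ : Matrix I I ℂ) :
    marg f' g' (marg f g ρ) = marg (fun i => f' (f i)) (fun i => (g' (f i), g i)) ρ := by
  ext a b
  have h := trace_marg_mul f g ρ
    (Matrix.of fun x' x => if f' x = a ∧ f' x' = b ∧ g' x = g' x' then 1 else 0)
  simp only [Matrix.trace, Matrix.diag, Matrix.mul_apply, Matrix.of_apply, mul_ite, mul_one,
    mul_zero] at h
  rw [marg, Matrix.of_apply, h]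
  simp only [marg, Matrix.of_apply, Prod.mk.injEq]
  refine Finset.sum_congr rfl fun i _ => Finset.sum_congr rfl fun j _ => ?_
  by_cases h : g i = g j
  · simp [h]
  · simp [h, Ne.symm h]

theorem marg_submatrix {I' : Type} [Fintype I'] (e : I' ≃ I) (f : I' → X) (g : I' → Y)
    (ρ : Matrix I I ℂ) :
    marg f g (ρ.submatrix e e) = marg (fun i => f (e.symm i)) (fun i => g (e.symm i)) ρ := by
  ext x x'
  simp only [marg, Matrix.of_apply]
  exact Fintype.sum_equiv e _ _ fun i => Fintype.sum_equiv e _ _ fun j => by simp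

theorem marg_equiv_apply [Fintype X] [Fintype Y] (e : I ≃ X × Y) (ρ : Matrix I I ℂ) (x x' : X) :
    marg (fun i => (e i).1) (fun i => (e i).2) ρ x x'
      = ∑ y, ρ (e.symm (x, y)) (e.symm (x', y)) := by
  simp only [marg, Matrix.of_apply]
  rw [Fintype.sum_equiv e _ (fun p => ∑ q : X × Y,
    if p.1 = x ∧ q.1 = x' ∧ p.2 = q.2 then ρ (e.symm p) (e.symm q) else 0)
    (fun i => Fintype.sum_equiv e _ _ fun j => by simp)]
  simp only [Fintype.sum_prod_type]
  rw [Finset.sum_eq_single x (by intro z _ hz; simp [hz]) (by simp)]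
  refine Finset.sum_congr rfl fun y _ => ?_
  rw [Finset.sum_eq_single x' (by intro z _ hz; simp [hz]) (by simp),
    Finset.sum_eq_single y (by intro z _ hz; simp [hz.symm]) (by simp)]
  simp

theorem marg_id_unit (ρ : Matrix X X ℂ) [Fintype X] : marg id (fun _ => ()) ρ = ρ := by
  ext x x'
  simp only [marg, Matrix.of_apply, id]
  rw [Finset.sum_eq_single x (by intro z _ hz; simp [hz]) (by simp),
    Finset.sum_eq_single x' (by intro z _ hz; simp [hz]) (by simp)]
  simp

theorem vecState_posSemidef {J : Type} [Finite J] (ψ : J → ℂ) : (vecState ψ).PosSemidef :=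
  Matrix.posSemidef_vecMulVec_self_star ψ

/-- Complementary marginals of a pure state have the same entropy. -/
theorem matEntropy_marg_vecState_swap [Fintype X] [Fintype Y] (f : I → X) (g : I → Y)
    (ψ : I → ℂ) :
    matEntropy (marg f g (vecState ψ)) = matEntropy (marg g f (vecState ψ)) := by
  rw [matEntropy_eq_charpolyEntropy (marg_posSemidef f g (vecState_posSemidef ψ)).1,
    matEntropy_eq_charpolyEntropy (marg_posSemidef g f (vecState_posSemidef ψ)).1]
  have key {X Y : Type} [DecidableEq X] [DecidableEq Y] [Fintype Y] (f : I → X) (g : I → Y) :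
      marg f g (vecState ψ)
      = (Matrix.of fun x y => ∑ i, if f i = x ∧ g i = y then ψ i else 0) *
        (Matrix.of fun x y => ∑ i, if f i = x ∧ g i = y then ψ i else 0).conjTranspose := by
    ext x x'
    simp only [marg, Matrix.of_apply, Matrix.mul_apply, Matrix.conjTranspose_apply, vecState,
      star_sum, Finset.sum_mul_sum]
    symm
    rw [Finset.sum_comm]
    refine Finset.sum_congr rfl fun i _ => ?_
    rw [Finset.sum_comm]
    refine Finset.sum_congr rfl fun j _ => ?_
    rw [Finset.sum_eq_single (g i)]
    · simp only [@eq_comm _ (g j)]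
      by_cases h1 : f i = x <;> by_cases h2 : f j = x' <;> by_cases h3 : g i = g j <;>
        simp [h1, h2, h3]
    · intro y _ hy
      simp [hy.symm]
    · simp
  rw [key f g, key g f, charpolyEntropy_mul_comm, ← charpolyEntropy_transpose,
    Matrix.transpose_mul]
  congr 1
  congr 1 <;> ext a b <;> simp [and_comm]

end marg

theorem posSemidef_matEntropy_nonneg {I : Type} [Fintype I] [DecidableEq I] {ρ : Matrix I I ℂ}
    (h : ρ.PosSemidef) (ht : ρ.trace = 1) : 0 ≤ matEntropy ρ := by
  rw [matEntropy, dif_pos h.1]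
  refine Finset.sum_nonneg fun i _ => Real.negMulLog_nonneg (h.eigenvalues_nonneg i) ?_
  have hs : ∑ i, h.1.eigenvalues i = 1 := by
    have := congrArg Complex.re h.1.trace_eq_sum_eigenvalues
    simpa [ht] using this.symm
  rw [← hs]
  exact Finset.single_le_sum (fun j _ => h.eigenvalues_nonneg j) (Finset.mem_univ i)

theorem matEntropy_eq_zero_of_unique {I : Type} [Fintype I] [DecidableEq I] [Unique I]
    {ρ : Matrix I I ℂ} (h : ρ.IsHermitian) (ht : ρ.trace = 1) : matEntropy ρ = 0 := by
  rw [matEntropy, dif_pos h]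
  have hs : ∑ i, h.eigenvalues i = 1 := by
    have := congrArg Complex.re h.trace_eq_sum_eigenvalues
    simpa [ht] using this.symm
  rw [Fintype.sum_unique] at hs ⊢
  simp [hs]

theorem matEntropy_vecState {I : Type} [Fintype I] [DecidableEq I] {ψ : I → ℂ}
    (h : (vecState ψ).trace = 1) : matEntropy (vecState ψ) = 0 := by
  rw [← marg_id_unit (vecState ψ), matEntropy_marg_vecState_swap]
  refine matEntropy_eq_zero_of_unique (marg_posSemidef _ _ (vecState_posSemidef ψ)).1 ?_
  rw [trace_marg (fun _ => ()) id (fun i j _ h => h), h]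

section relativeEntropy

open Filter Topology

theorem hasDerivAt_sum_mul_log {K : Type} [Fintype K] {c p q : K → ℝ} (hp : ∀ k, 0 ≤ p k)
    (hq : ∀ k, 0 ≤ q k) {s : ℝ} (hs : 0 < s) :
    HasDerivAt (fun s => ∑ k, c k * p k * Real.log (q k + s * p k))
      (∑ k, c k * (p k ^ 2 / (q k + s * p k))) s := by
  refine HasDerivAt.fun_sum fun k _ => ?_
  rcases (hp k).eq_or_lt with h | h
  · simpa [← h] using hasDerivAt_const s (0 : ℝ)
  · have hpos : 0 < q k + s * p k := add_pos_of_nonneg_of_pos (hq k) (mul_pos hs h)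
    have h1 : HasDerivAt (fun s => q k + s * p k) (p k) s := by
      simpa using ((hasDerivAt_id s).mul_const (p k)).const_add (q k)
    refine ((h1.log hpos.ne').const_mul (c k * p k)).congr_deriv ?_
    ring

theorem tendsto_sum_mul_log_zero {K : Type} [Fintype K] {c p q : K → ℝ}
    (hpq : ∀ k, c k * p k ≠ 0 → q k ≠ 0) :
    Tendsto (fun s => ∑ k, c k * p k * Real.log (q k + s * p k)) (𝓝[>] 0)
      (𝓝 (∑ k, c k * p k * Real.log (q k))) := by
  refine tendsto_finsetSum _ fun k _ => ?_
  by_cases h : c k * p k = 0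
  · simp [h]
  · have h1 : Tendsto (fun s : ℝ => q k + s * p k) (𝓝[>] 0) (𝓝 (q k)) := by
      have : Continuous fun s : ℝ => q k + s * p k := by fun_prop
      simpa using (this.tendsto 0).mono_left nhdsWithin_le_nhds
    exact (h1.log (hpq k h)).const_mul _

theorem tendsto_sum_mul_log_atTop {K : Type} [Fintype K] {c p q : K → ℝ} (hp : ∀ k, 0 ≤ p k)
    (hq : ∀ k, 0 ≤ q k) :
    Tendsto (fun s => ∑ k, c k * p k * Real.log (q k + s * p k)
        - (∑ k, c k * p k) * Real.log s) atTop
      (𝓝 (∑ k, c k * p k * Real.log (p k))) := by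
  simp_rw [Finset.sum_mul, ← Finset.sum_sub_distrib]
  refine tendsto_finsetSum _ fun k _ => ?_
  rcases (hp k).eq_or_lt with h | h
  · simp [← h]
  · have h1 : Tendsto (fun s : ℝ => q k * s⁻¹ + p k) atTop (𝓝 (p k)) := by
      simpa using (tendsto_inv_atTop_zero.const_mul (q k)).add_const (p k)
    refine ((h1.log h.ne').const_mul (c k * p k)).congr' ?_
    filter_upwards [eventually_gt_atTop 0] with s hs
    have hpos : 0 < q k + s * p k := add_pos_of_nonneg_of_pos (hq k) (mul_pos hs h)
    rw [← mul_sub, ← Real.log_div hpos.ne' hs.ne']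
    congr 2
    field_simp

theorem sum_mul_log_sub_le {K L : Type} [Fintype K] [Fintype L] {c p q : K → ℝ}
    {c' p' q' : L → ℝ} (hp : ∀ k, 0 ≤ p k) (hq : ∀ k, 0 ≤ q k) (hp' : ∀ k, 0 ≤ p' k)
    (hq' : ∀ k, 0 ≤ q' k) (hpq : ∀ k, c k * p k ≠ 0 → q k ≠ 0)
    (hpq' : ∀ k, c' k * p' k ≠ 0 → q' k ≠ 0)
    (hsum : ∑ k, c k * p k = ∑ k, c' k * p' k)
    (hle : ∀ s > 0, ∑ k, c' k * (p' k ^ 2 / (q' k + s * p' k))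
      ≤ ∑ k, c k * (p k ^ 2 / (q k + s * p k))) :
    ∑ k, c k * p k * Real.log (q k) - ∑ k, c' k * p' k * Real.log (q' k)
      ≤ ∑ k, c k * p k * Real.log (p k) - ∑ k, c' k * p' k * Real.log (p' k) := by
  set F : ℝ → ℝ := fun s => ∑ k, c k * p k * Real.log (q k + s * p k)
    - ∑ k, c' k * p' k * Real.log (q' k + s * p' k) with hF
  have hd (s : ℝ) (hs : 0 < s) :=
    (hasDerivAt_sum_mul_log (c := c) hp hq hs).sub (hasDerivAt_sum_mul_log (c := c') hp' hq' hs)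
  have hmono : MonotoneOn F (Set.Ioi 0) := by
    refine monotoneOn_of_deriv_nonneg (convex_Ioi 0)
      (fun s hs => (hd s hs).continuousAt.continuousWithinAt)
      (fun s hs => ?_) (fun s hs => ?_)
    · rw [interior_Ioi] at hs
      exact (hd s hs).differentiableAt.differentiableWithinAt
    · rw [interior_Ioi] at hs
      exact (hd s hs).deriv.symm ▸ sub_nonneg.2 (hle s hs)
  have h0 : ∑ k, c k * p k * Real.log (q k) - ∑ k, c' k * p' k * Real.log (q' k) ≤ F 1 := by
    refine le_of_tendsto ((tendsto_sum_mul_log_zero hpq).sub (tendsto_sum_mul_log_zero hpq')) ?_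
    filter_upwards [Ioo_mem_nhdsGT (zero_lt_one' ℝ)] with s hs
    exact hmono hs.1 (Set.mem_Ioi.2 one_pos) hs.2.le
  refine h0.trans (ge_of_tendsto
    ((tendsto_sum_mul_log_atTop hp hq).sub (tendsto_sum_mul_log_atTop hp' hq')) ?_)
  filter_upwards [eventually_ge_atTop 1] with s hs
  have := hmono (Set.mem_Ioi.2 one_pos) (Set.mem_Ioi.2 (one_pos.trans_le hs)) hs
  rw [hsum, sub_sub_sub_cancel_right]
  exact this

open Matrix

theorem quadratic_form_eq {I : Type} [Fintype I] [DecidableEq I] {U V : Matrix I I ℂ}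
    (hU : Uᴴ * U = 1) (hV : Vᴴ * V = 1) (p q : I → ℝ) (s : ℝ) (y : Matrix I I ℂ) :
    2 * (U * diagonal (fun i => (p i : ℂ)) * Uᴴ * (V * y * Uᴴ)).trace.re
      - (V * diagonal (fun i => (q i : ℂ)) * Vᴴ * ((V * y * Uᴴ) * (V * y * Uᴴ)ᴴ)).trace.re
      - s * (U * diagonal (fun i => (p i : ℂ)) * Uᴴ * ((V * y * Uᴴ)ᴴ * (V * y * Uᴴ))).trace.re
    = ∑ k : I × I, (2 * (p k.1 * ((Uᴴ * V) k.1 k.2 * y k.2 k.1).re)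
        - (q k.2 + s * p k.1) * Complex.normSq (y k.2 k.1)) := by
  have h1 : (U * diagonal (fun i => (p i : ℂ)) * Uᴴ * (V * y * Uᴴ)).trace
      = (diagonal (fun i => (p i : ℂ)) * ((Uᴴ * V) * y)).trace := by
    rw [show U * diagonal (fun i => (p i : ℂ)) * Uᴴ * (V * y * Uᴴ)
      = U * (diagonal (fun i => (p i : ℂ)) * ((Uᴴ * V) * y) * Uᴴ) by simp only [Matrix.mul_assoc],
      trace_mul_comm, Matrix.mul_assoc, hU, Matrix.mul_one]
  have h2 : (V * diagonal (fun i => (q i : ℂ)) * Vᴴ * ((V * y * Uᴴ) * (V * y * Uᴴ)ᴴ)).trace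
      = (diagonal (fun i => (q i : ℂ)) * (y * yᴴ)).trace := by
    rw [show V * diagonal (fun i => (q i : ℂ)) * Vᴴ * ((V * y * Uᴴ) * (V * y * Uᴴ)ᴴ)
      = V * (diagonal (fun i => (q i : ℂ)) * (Vᴴ * V) * (y * (Uᴴ * U) * yᴴ) * Vᴴ) by
        simp only [Matrix.mul_assoc, conjTranspose_mul, conjTranspose_conjTranspose],
      trace_mul_comm, Matrix.mul_assoc _ _ V, hU, hV, Matrix.mul_one, Matrix.mul_one,
      Matrix.mul_one]
  have h3 : (U * diagonal (fun i => (p i : ℂ)) * Uᴴ * ((V * y * Uᴴ)ᴴ * (V * y * Uᴴ))).trace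
      = (diagonal (fun i => (p i : ℂ)) * (yᴴ * y)).trace := by
    rw [show U * diagonal (fun i => (p i : ℂ)) * Uᴴ * ((V * y * Uᴴ)ᴴ * (V * y * Uᴴ))
      = U * (diagonal (fun i => (p i : ℂ)) * (Uᴴ * U) * (yᴴ * (Vᴴ * V) * y) * Uᴴ) by
        simp only [Matrix.mul_assoc, conjTranspose_mul, conjTranspose_conjTranspose],
      trace_mul_comm, Matrix.mul_assoc _ _ U, hU, hV, Matrix.mul_one, Matrix.mul_one,
      Matrix.mul_one]
  rw [h1, h2, h3, Fintype.sum_prod_type]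
  have e1 : (diagonal (fun i => (p i : ℂ)) * ((Uᴴ * V) * y)).trace.re
      = ∑ i, ∑ j, p i * ((Uᴴ * V) i j * y j i).re := by
    simp only [trace, diag, diagonal_mul, Complex.re_sum, Complex.re_ofReal_mul]
    refine Finset.sum_congr rfl fun i _ => ?_
    rw [Matrix.mul_apply, Complex.re_sum, Finset.mul_sum]
  have e2 : (diagonal (fun i => (q i : ℂ)) * (y * yᴴ)).trace.re
      = ∑ i, ∑ j, q j * Complex.normSq (y j i) := by
    simp only [trace, diag, diagonal_mul, Complex.re_sum, Complex.re_ofReal_mul]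
    rw [Finset.sum_comm]
    refine Finset.sum_congr rfl fun i _ => ?_
    rw [Matrix.mul_apply, Complex.re_sum, Finset.mul_sum]
    simp [Complex.normSq_apply]
  have e3 : (diagonal (fun i => (p i : ℂ)) * (yᴴ * y)).trace.re
      = ∑ i, ∑ j, p i * Complex.normSq (y j i) := by
    simp only [trace, diag, diagonal_mul, Complex.re_sum, Complex.re_ofReal_mul]
    refine Finset.sum_congr rfl fun i _ => ?_
    rw [Matrix.mul_apply, Complex.re_sum, Finset.mul_sum]
    simp [Complex.normSq_apply]
  rw [e1, e2, e3]
  simp only [Finset.mul_sum, ← Finset.sum_sub_distrib]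
  refine Finset.sum_congr rfl fun i _ => Finset.sum_congr rfl fun j _ => ?_
  ring

theorem two_mul_re_sub_le {p q s : ℝ} (hp : 0 ≤ p) (hq : 0 ≤ q) (hs : 0 < s) (u y : ℂ) :
    2 * (p * (u * y).re) - (q + s * p) * Complex.normSq y
      ≤ Complex.normSq u * (p ^ 2 / (q + s * p)) := by
  rcases hp.eq_or_lt with rfl | h
  · simpa using mul_nonneg hq (Complex.normSq_nonneg y)
  · have hpos : 0 < q + s * p := add_pos_of_nonneg_of_pos hq (mul_pos hs h)
    rw [mul_div_assoc', le_div_iff₀ hpos]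
    simp only [Complex.normSq_apply, Complex.mul_re]
    nlinarith [sq_nonneg (p * u.re - (q + s * p) * y.re), sq_nonneg (p * u.im + (q + s * p) * y.im)]

theorem two_mul_re_sub_eq {p q s : ℝ} (hp : 0 ≤ p) (hq : 0 ≤ q) (hs : 0 < s) (u : ℂ) :
    2 * (p * (u * (((p / (q + s * p) : ℝ) : ℂ) * star u)).re)
        - (q + s * p) * Complex.normSq (((p / (q + s * p) : ℝ) : ℂ) * star u)
      = Complex.normSq u * (p ^ 2 / (q + s * p)) := by
  rcases hp.eq_or_lt with rfl | h
  · simp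
  · have hpos : 0 < q + s * p := add_pos_of_nonneg_of_pos hq (mul_pos hs h)
    have : u * (((p / (q + s * p) : ℝ) : ℂ) * star u)
        = ((p / (q + s * p) * Complex.normSq u : ℝ) : ℂ) := by
      rw [Complex.ofReal_mul, Complex.normSq_eq_conj_mul_self]
      simp only [Complex.star_def]
      ring
    rw [this, Complex.ofReal_re, Complex.normSq_mul, Complex.normSq_ofReal, Complex.star_def,
      Complex.normSq_conj]
    field_simp
    ring

/-- **Monotonicity of the relative entropy** under the dual of a `*`-homomorphism `Φ`, for
spectrally decomposed density matrices. -/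
theorem relativeEntropy_mono {I J : Type} [Fintype I] [DecidableEq I] [Fintype J] [DecidableEq J]
    {U V : Matrix I I ℂ} {U' V' : Matrix J J ℂ} {p q : I → ℝ} {p' q' : J → ℝ}
    (hU : Uᴴ * U = 1) (hV : Vᴴ * V = 1) (hU' : U'ᴴ * U' = 1) (hV' : V'ᴴ * V' = 1)
    (hp : ∀ i, 0 ≤ p i) (hq : ∀ i, 0 ≤ q i) (hp' : ∀ i, 0 ≤ p' i) (hq' : ∀ i, 0 ≤ q' i)
    (hpq : ∀ k : I × I, Complex.normSq ((Uᴴ * V) k.1 k.2) * p k.1 ≠ 0 → q k.2 ≠ 0)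
    (hpq' : ∀ k : J × J, Complex.normSq ((U'ᴴ * V') k.1 k.2) * p' k.1 ≠ 0 → q' k.2 ≠ 0)
    (Φ : Matrix J J ℂ → Matrix I I ℂ) (hΦ_one : Φ 1 = 1) (hΦ_mul : ∀ Y Z, Φ (Y * Z) = Φ Y * Φ Z)
    (hΦ_star : ∀ Y, Φ Yᴴ = (Φ Y)ᴴ)
    (hρ : ∀ Y, (U' * diagonal (fun i => (p' i : ℂ)) * U'ᴴ * Y).trace
      = (U * diagonal (fun i => (p i : ℂ)) * Uᴴ * Φ Y).trace)
    (hσ : ∀ Y, (V' * diagonal (fun i => (q' i : ℂ)) * V'ᴴ * Y).trace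
      = (V * diagonal (fun i => (q i : ℂ)) * Vᴴ * Φ Y).trace) :
    ∑ k : I × I, Complex.normSq ((Uᴴ * V) k.1 k.2) * p k.1 * Real.log (q k.2)
        - ∑ k : J × J, Complex.normSq ((U'ᴴ * V') k.1 k.2) * p' k.1 * Real.log (q' k.2)
      ≤ ∑ i, p i * Real.log (p i) - ∑ i, p' i * Real.log (p' i) := by
  have hrow {K : Type} [Fintype K] [DecidableEq K] {U V : Matrix K K ℂ} (hU : Uᴴ * U = 1)
      (hV : Vᴴ * V = 1) (f : K → ℝ) :
      ∑ k : K × K, Complex.normSq ((Uᴴ * V) k.1 k.2) * f k.1 = ∑ i, f i := by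
    rw [Fintype.sum_prod_type]
    refine Finset.sum_congr rfl fun i _ => ?_
    change ∑ j, Complex.normSq ((Uᴴ * V) i j) * f i = f i
    rw [← Finset.sum_mul]
    have h1 : (Uᴴ * V) * (Uᴴ * V)ᴴ = 1 := by
      rw [conjTranspose_mul, conjTranspose_conjTranspose, Matrix.mul_assoc,
        ← Matrix.mul_assoc V, mul_eq_one_comm.1 hV, Matrix.one_mul, hU]
    have h2 := congrArg Complex.re (congrFun (congrFun h1 i) i)
    rw [Matrix.mul_apply, Complex.re_sum] at h2
    have h3 : ∑ j, Complex.normSq ((Uᴴ * V) i j) = 1 := by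
      rw [one_apply_eq, Complex.one_re] at h2
      rw [← h2]
      exact Finset.sum_congr rfl fun j _ => by
        rw [conjTranspose_apply, Complex.star_def, Complex.mul_conj, Complex.ofReal_re]
    rw [h3, one_mul]
  have htr {K : Type} [Fintype K] [DecidableEq K] {U : Matrix K K ℂ} (hU : Uᴴ * U = 1)
      (p : K → ℝ) : (U * diagonal (fun i => (p i : ℂ)) * Uᴴ * 1).trace = ((∑ i, p i : ℝ) : ℂ) := by
    rw [Matrix.mul_one, trace_mul_comm, ← Matrix.mul_assoc, hU, Matrix.one_mul, trace_diagonal]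
    push_cast
    rfl
  have key := sum_mul_log_sub_le (c := fun k : I × I => Complex.normSq ((Uᴴ * V) k.1 k.2))
    (c' := fun k : J × J => Complex.normSq ((U'ᴴ * V') k.1 k.2))
    (p := fun k => p k.1) (q := fun k => q k.2) (p' := fun k => p' k.1) (q' := fun k => q' k.2)
    (fun k => hp _) (fun k => hq _) (fun k => hp' _) (fun k => hq' _) hpq hpq' ?_ ?_
  · simpa only [mul_assoc, hrow hU hV (fun i => p i * Real.log (p i)),
      hrow hU' hV' (fun i => p' i * Real.log (p' i))] using key
  · have h := hρ 1
    rw [hΦ_one, htr hU', htr hU, Complex.ofReal_inj] at h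
    rw [hrow hU hV, hrow hU' hV', h]
  · intro s hs
    set y' : Matrix J J ℂ := Matrix.of fun j i =>
      ((p' i / (q' j + s * p' i) : ℝ) : ℂ) * star ((U'ᴴ * V') i j)
    have h1 := quadratic_form_eq hU' hV' p' q' s y'
    obtain ⟨Y, hY⟩ : ∃ Y, Y = V' * y' * U'ᴴ := ⟨_, rfl⟩
    rw [← hY, hρ, hσ, hρ, hΦ_mul, hΦ_mul, hΦ_star] at h1
    generalize Φ Y = Z at h1
    have h2 := quadratic_form_eq hU hV p q s (Vᴴ * Z * U)
    rw [show V * (Vᴴ * Z * U) * Uᴴ = (V * Vᴴ) * Z * (U * Uᴴ) by simp only [Matrix.mul_assoc],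
      mul_eq_one_comm.1 hU, mul_eq_one_comm.1 hV, Matrix.one_mul, Matrix.mul_one] at h2
    rw [h2] at h1
    calc _ = _ := (Finset.sum_congr rfl fun k _ =>
            two_mul_re_sub_eq (hp' k.1) (hq' k.2) hs ((U'ᴴ * V') k.1 k.2)).symm
      _ = _ := h1.symm
      _ ≤ _ := Finset.sum_le_sum fun k _ => two_mul_re_sub_le (hp k.1) (hq k.2) hs _ _

end relativeEntropy

section mutualInformation

open Matrix

open scoped Kronecker

theorem exists_spectral_decomposition {I : Type} [Fintype I] [DecidableEq I] {ρ : Matrix I I ℂ}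
    (h : ρ.PosSemidef) :
    ∃ (U : Matrix I I ℂ) (p : I → ℝ), Uᴴ * U = 1 ∧ (∀ i, 0 ≤ p i) ∧
      ρ = U * diagonal (fun i => (p i : ℂ)) * Uᴴ ∧
      matEntropy ρ = -∑ i, p i * Real.log (p i) := by
  refine ⟨h.1.eigenvectorUnitary, h.1.eigenvalues, ?_, h.eigenvalues_nonneg, ?_, ?_⟩
  · exact Unitary.coe_star_mul_self h.1.eigenvectorUnitary
  · conv_lhs => rw [h.1.spectral_theorem, Unitary.conjStarAlgAut_apply]
    rfl
  · rw [matEntropy, dif_pos h.1, ← Finset.sum_neg_distrib]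
    simp [Real.negMulLog]

theorem trace_spectral_mul {I : Type} [Fintype I] [DecidableEq I] (U V : Matrix I I ℂ)
    (p d : I → ℝ) :
    (U * diagonal (fun i => (p i : ℂ)) * Uᴴ * (V * diagonal (fun i => (d i : ℂ)) * Vᴴ)).trace
      = ((∑ x, (∑ i, Complex.normSq ((Uᴴ * V) i x) * p i) * d x : ℝ) : ℂ) := by
  rw [show U * diagonal (fun i => (p i : ℂ)) * Uᴴ * (V * diagonal (fun i => (d i : ℂ)) * Vᴴ)
    = U * (diagonal (fun i => (p i : ℂ)) * ((Uᴴ * V) * diagonal (fun i => (d i : ℂ))) * Vᴴ) by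
      simp only [Matrix.mul_assoc], trace_mul_comm, Matrix.mul_assoc,
    show Vᴴ * U = (Uᴴ * V)ᴴ by rw [conjTranspose_mul, conjTranspose_conjTranspose]]
  generalize Uᴴ * V = W
  have h (i : I) : (diagonal (fun i => (p i : ℂ)) * (W * diagonal (fun i => (d i : ℂ))) * Wᴴ) i i
      = ∑ x, p i * (W i x * d x) * star (W i x) := by
    rw [Matrix.mul_apply]
    refine Finset.sum_congr rfl fun x _ => ?_
    rw [diagonal_mul, mul_diagonal, conjTranspose_apply]
  simp only [trace, diag, ← Matrix.mul_assoc] at h ⊢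
  simp_rw [h]
  rw [Finset.sum_comm]
  push_cast
  refine Finset.sum_congr rfl fun x _ => ?_
  rw [Finset.sum_mul]
  refine Finset.sum_congr rfl fun i _ => ?_
  rw [← Complex.mul_conj, Complex.star_def]
  ring

variable {κ : Type} [Fintype κ]

section piKronecker

variable {X : κ → Type}

/-- The Kronecker product of a finite family of square matrices. -/
def piKronecker (A : ∀ k, Matrix (X k) (X k) ℂ) : Matrix (∀ k, X k) (∀ k, X k) ℂ :=
  Matrix.of fun x y => ∏ k, A k (x k) (y k)

theorem piKronecker_conjTranspose (A : ∀ k, Matrix (X k) (X k) ℂ) :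
    (piKronecker A)ᴴ = piKronecker fun k => (A k)ᴴ := by
  ext x y
  simp [piKronecker]

theorem piKronecker_diagonal [∀ k, DecidableEq (X k)] (d : ∀ k, X k → ℂ) :
    piKronecker (fun k => diagonal (d k)) = diagonal fun x => ∏ k, d k (x k) := by
  ext x y
  by_cases h : x = y
  · subst h
    simp [piKronecker]
  · obtain ⟨k, hk⟩ := Function.ne_iff.1 h
    rw [diagonal_apply_ne _ h, piKronecker, Matrix.of_apply]
    exact Finset.prod_eq_zero (Finset.mem_univ k) (diagonal_apply_ne _ hk)

variable [DecidableEq κ] [∀ k, Fintype (X k)]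

theorem piKronecker_mul (A B : ∀ k, Matrix (X k) (X k) ℂ) :
    piKronecker A * piKronecker B = piKronecker fun k => A k * B k := by
  ext x y
  simp only [piKronecker, Matrix.mul_apply, Matrix.of_apply, ← Finset.prod_mul_distrib]
  rw [Finset.prod_univ_sum, Fintype.piFinset_univ]

variable [∀ k, DecidableEq (X k)]

/-- The reduction of a multipartite matrix to its `k`-th tensor factor. -/
def margAt (k : κ) (ρ : Matrix (∀ k, X k) (∀ k, X k) ℂ) : Matrix (X k) (X k) ℂ :=
  marg (fun x => x k) (fun x (l : {l // l ≠ k}) => x l) ρ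

theorem trace_margAt_mul (k : κ) (ρ : Matrix (∀ k, X k) (∀ k, X k) ℂ) (Z : Matrix (X k) (X k) ℂ) :
    (margAt k ρ * Z).trace = (ρ * piKronecker (Function.update (fun _ => 1) k Z)).trace := by
  rw [margAt, trace_marg_mul]
  congr 2
  ext x y
  simp only [piKronecker, Matrix.of_apply]
  rw [Fintype.prod_eq_mul_prod_compl k, Function.update_self]
  split_ifs with h
  · rw [Finset.prod_eq_one, mul_one]
    intro l hl
    have hl : l ≠ k := by simpa using hl
    rw [Function.update_of_ne hl, show x l = y l from congrFun h ⟨l, hl⟩, one_apply_eq]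
  · obtain ⟨⟨l, hl⟩, hxy⟩ := Function.ne_iff.1 h
    rw [Finset.prod_eq_zero (i := l) (by simpa using hl), mul_zero]
    rw [Function.update_of_ne hl, one_apply_ne hxy]

theorem sum_overlap_eq {U : Matrix (∀ k, X k) (∀ k, X k) ℂ} {p : (∀ k, X k) → ℝ}
    {V : ∀ k, Matrix (X k) (X k) ℂ} {q : ∀ k, X k → ℝ} (hV : ∀ k, (V k)ᴴ * V k = 1)
    (hR : ∀ k, margAt k (U * diagonal (fun i => (p i : ℂ)) * Uᴴ)
      = V k * diagonal (fun a => (q k a : ℂ)) * (V k)ᴴ) (k : κ) (a : X k) :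
    ∑ x, (∑ i, Complex.normSq ((Uᴴ * piKronecker V) i x) * p i) * (if x k = a then 1 else 0)
      = q k a := by
  have hD : diagonal (fun x : ∀ k, X k => (((if x k = a then 1 else 0 : ℝ)) : ℂ))
      = piKronecker (Function.update (fun _ => 1) k (diagonal (Pi.single a 1))) := by
    have h : Function.update (fun l : κ => (1 : Matrix (X l) (X l) ℂ)) k (diagonal (Pi.single a 1))
        = fun l => diagonal (Function.update (fun (l : κ) (_ : X l) => (1 : ℂ)) k
            (Pi.single a 1) l) := by
      funext l
      by_cases hl : l = k
      · subst hl
        simp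
      · simp [hl]
    rw [h, piKronecker_diagonal]
    congr 1
    funext x
    rw [Fintype.prod_eq_mul_prod_compl k, Function.update_self, Finset.prod_eq_one, mul_one]
    · by_cases hx : x k = a <;> simp [hx]
    · intro l hl
      have hl : l ≠ k := by simpa using hl
      rw [Function.update_of_ne hl]
  have h1 := trace_spectral_mul U (piKronecker V) p fun x => if x k = a then 1 else 0
  have h2 : piKronecker V * diagonal (fun x : ∀ k, X k => (((if x k = a then 1 else 0 : ℝ)) : ℂ))
      * (piKronecker V)ᴴ
      = piKronecker (Function.update (fun _ => 1) k (V k * diagonal (Pi.single a 1) * (V k)ᴴ)) := by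
    rw [hD, piKronecker_conjTranspose, piKronecker_mul, piKronecker_mul]
    congr 1
    funext l
    by_cases hl : l = k
    · subst hl
      simp
    · simp [hl, mul_eq_one_comm.1 (hV l)]
  rw [h2, ← trace_margAt_mul, hR,
    show V k * diagonal (fun a => (q k a : ℂ)) * (V k)ᴴ * (V k * diagonal (Pi.single a 1) * (V k)ᴴ)
      = V k * (diagonal (fun a => (q k a : ℂ)) * ((V k)ᴴ * V k) * diagonal (Pi.single a 1)
        * (V k)ᴴ) by simp only [Matrix.mul_assoc],
    trace_mul_comm, Matrix.mul_assoc _ _ (V k), hV, Matrix.mul_one, Matrix.mul_one,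
    diagonal_mul_diagonal, trace_diagonal] at h1
  simp only [Pi.single_apply, mul_ite, mul_one, mul_zero, Finset.sum_ite_eq', Finset.mem_univ,
    if_true] at h1
  simp only [mul_ite, mul_one, mul_zero]
  exact (Complex.ofReal_inj.1 h1).symm

theorem overlap_support {U : Matrix (∀ k, X k) (∀ k, X k) ℂ} {p : (∀ k, X k) → ℝ}
    (hp : ∀ i, 0 ≤ p i)
    {V : ∀ k, Matrix (X k) (X k) ℂ} {q : ∀ k, X k → ℝ} (hV : ∀ k, (V k)ᴴ * V k = 1)
    (hR : ∀ k, margAt k (U * diagonal (fun i => (p i : ℂ)) * Uᴴ)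
      = V k * diagonal (fun a => (q k a : ℂ)) * (V k)ᴴ) (i x : ∀ k, X k)
    (h : Complex.normSq ((Uᴴ * piKronecker V) i x) * p i ≠ 0) (k : κ) : q k (x k) ≠ 0 := by
  intro h0
  have hw (x i) : 0 ≤ Complex.normSq ((Uᴴ * piKronecker V) i x) * p i :=
    mul_nonneg (Complex.normSq_nonneg _) (hp i)
  have h1 := sum_overlap_eq hV hR k (x k)
  rw [h0, Finset.sum_eq_zero_iff_of_nonneg fun y _ => mul_nonneg
    (Finset.sum_nonneg fun i _ => hw y i) (by split_ifs <;> norm_num)] at h1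
  have h2 := h1 x (Finset.mem_univ x)
  rw [if_pos rfl, mul_one, Finset.sum_eq_zero_iff_of_nonneg fun i _ => hw x i] at h2
  exact h (h2 i (Finset.mem_univ i))

theorem sum_overlap_log {U : Matrix (∀ k, X k) (∀ k, X k) ℂ} {p : (∀ k, X k) → ℝ}
    (hp : ∀ i, 0 ≤ p i)
    {V : ∀ k, Matrix (X k) (X k) ℂ} {q : ∀ k, X k → ℝ} (hV : ∀ k, (V k)ᴴ * V k = 1)
    (hR : ∀ k, margAt k (U * diagonal (fun i => (p i : ℂ)) * Uᴴ)
      = V k * diagonal (fun a => (q k a : ℂ)) * (V k)ᴴ) :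
    ∑ m : (∀ k, X k) × (∀ k, X k), Complex.normSq ((Uᴴ * piKronecker V) m.1 m.2) * p m.1 *
      Real.log (∏ k, q k (m.2 k)) = ∑ k, ∑ a, q k a * Real.log (q k a) := by
  have h1 (m : (∀ k, X k) × (∀ k, X k)) :
      Complex.normSq ((Uᴴ * piKronecker V) m.1 m.2) * p m.1 * Real.log (∏ k, q k (m.2 k))
      = ∑ k, Complex.normSq ((Uᴴ * piKronecker V) m.1 m.2) * p m.1 * Real.log (q k (m.2 k)) := by
    by_cases h : Complex.normSq ((Uᴴ * piKronecker V) m.1 m.2) * p m.1 = 0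
    · simp [h]
    · rw [Real.log_prod fun k _ => overlap_support hp hV hR _ _ h k, Finset.mul_sum]
  simp_rw [h1]
  rw [Finset.sum_comm]
  refine Finset.sum_congr rfl fun k _ => ?_
  rw [Fintype.sum_prod_type, Finset.sum_comm]
  calc _ = ∑ x, (∑ i, Complex.normSq ((Uᴴ * piKronecker V) i x) * p i)
          * Real.log (q k (x k)) := by simp_rw [Finset.sum_mul]
    _ = ∑ x, ∑ a, (∑ i, Complex.normSq ((Uᴴ * piKronecker V) i x) * p i)
          * (if x k = a then 1 else 0) * Real.log (q k a) := by
        refine Finset.sum_congr rfl fun x _ => ?_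
        simp
    _ = _ := by
        rw [Finset.sum_comm]
        refine Finset.sum_congr rfl fun a _ => ?_
        rw [← Finset.sum_mul, sum_overlap_eq hV hR]

end piKronecker

theorem marg_congr_right {I X Y Y' : Type} [Fintype I] [DecidableEq X] [DecidableEq Y]
    [DecidableEq Y'] (f : I → X) {g : I → Y} {g' : I → Y'} (h : ∀ i j, g i = g j ↔ g' i = g' j)
    (ρ : Matrix I I ℂ) : marg f g ρ = marg f g' ρ := by
  simp_rw [marg, h]

/-- **Monotonicity of the multipartite mutual information** under local partial traces. -/
theorem mutualInformation_mono [DecidableEq κ] {α δ : κ → Type} [∀ k, Fintype (α k)] [∀ k, DecidableEq (α k)]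
    [∀ k, Fintype (δ k)] [∀ k, DecidableEq (δ k)]
    {ρ : Matrix (∀ k, α k × δ k) (∀ k, α k × δ k) ℂ} (hρ : ρ.PosSemidef) :
    ∑ k, matEntropy (margAt k (marg (fun x k => (x k).1) (fun x k => (x k).2) ρ))
        - matEntropy (marg (fun x k => (x k).1) (fun x k => (x k).2) ρ)
      ≤ ∑ k, matEntropy (margAt k ρ) - matEntropy ρ := by
  let e : (∀ k, α k × δ k) ≃ (∀ k, α k) × (∀ k, δ k) :=
    ⟨fun x => (fun k => (x k).1, fun k => (x k).2), fun y k => (y.1 k, y.2 k),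
      fun _ => rfl, fun _ => rfl⟩
  set ρ' := marg (fun (x : ∀ k, α k × δ k) k => (x k).1) (fun x k => (x k).2) ρ with hρ'_def
  have hρ' : ρ'.PosSemidef := marg_posSemidef _ _ hρ
  have hmarg (k : κ) : margAt k ρ' = marg Prod.fst Prod.snd (margAt k ρ) := by
    rw [margAt, margAt, hρ'_def, marg_marg, marg_marg]
    refine marg_congr_right _ (fun x y => ?_) ρ
    simp only [Prod.mk.injEq, funext_iff, Subtype.forall, ne_eq]
    constructor
    · rintro ⟨h1, h2⟩
      exact ⟨h2 k, fun l hl => Prod.ext (h1 l hl) (h2 l)⟩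
    · rintro ⟨h1, h2⟩
      refine ⟨fun l hl => congrArg Prod.fst (h2 l hl), fun l => ?_⟩
      by_cases hl : l = k
      · exact hl ▸ h1
      · exact congrArg Prod.snd (h2 l hl)
  have hkron : piKronecker (fun k => margAt k ρ')
      = marg (fun x k => (x k).1) (fun x k => (x k).2) (piKronecker fun k => margAt k ρ) := by
    ext a b
    refine Eq.trans ?_ (marg_equiv_apply e _ a b).symm
    simp only [piKronecker, Matrix.of_apply]
    have (k : κ) : margAt k ρ' (a k) (b k) = ∑ d, margAt k ρ (a k, d) (b k, d) := by
      rw [hmarg]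
      exact marg_equiv_apply (Equiv.refl _) _ _ _
    simp_rw [this]
    rw [Finset.prod_univ_sum, Fintype.piFinset_univ]
    rfl
  obtain ⟨U, p, hU, hp, hUp, hS⟩ := exists_spectral_decomposition hρ
  obtain ⟨U', p', hU', hp', hUp', hS'⟩ := exists_spectral_decomposition hρ'
  choose V q hV hq hVq hT using fun k => exists_spectral_decomposition
    (ρ := margAt k ρ) (marg_posSemidef _ _ hρ)
  choose V' q' hV' hq' hVq' hT' using fun k => exists_spectral_decomposition
    (ρ := margAt k ρ') (marg_posSemidef _ _ hρ')
  have hkV {X : κ → Type} [∀ k, Fintype (X k)] [∀ k, DecidableEq (X k)]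
      {V : ∀ k, Matrix (X k) (X k) ℂ} (hV : ∀ k, (V k)ᴴ * V k = 1) :
      (piKronecker V)ᴴ * piKronecker V = 1 := by
    rw [piKronecker_conjTranspose, piKronecker_mul]
    simp_rw [hV, ← diagonal_one]
    rw [piKronecker_diagonal]
    simp
  have hkR {X : κ → Type} [∀ k, Fintype (X k)] [∀ k, DecidableEq (X k)]
      {R V : ∀ k, Matrix (X k) (X k) ℂ} {q : ∀ k, X k → ℝ}
      (hR : ∀ k, R k = V k * diagonal (fun a => (q k a : ℂ)) * (V k)ᴴ) :
      piKronecker V * diagonal (fun x => ((∏ k, q k (x k) : ℝ) : ℂ)) * (piKronecker V)ᴴ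
        = piKronecker R := by
    simp_rw [Complex.ofReal_prod]
    rw [← piKronecker_diagonal (fun k a => (q k a : ℂ)), piKronecker_conjTranspose,
      piKronecker_mul, piKronecker_mul, funext hR]
  have hlift (τ : Matrix (∀ k, α k × δ k) (∀ k, α k × δ k) ℂ)
      (Y : Matrix (∀ k, α k) (∀ k, α k) ℂ) :
      (marg (fun x k => (x k).1) (fun x k => (x k).2) τ * Y).trace
        = (τ * (Y ⊗ₖ (1 : Matrix (∀ k, δ k) (∀ k, δ k) ℂ)).submatrix e e).trace := by
    rw [trace_marg_mul]
    congr 2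
    ext x y
    simp [e, Matrix.one_apply]
  have hR : ∀ k, margAt k (U * diagonal (fun i => (p i : ℂ)) * Uᴴ)
      = V k * diagonal (fun a => (q k a : ℂ)) * (V k)ᴴ := hUp ▸ hVq
  have hR' : ∀ k, margAt k (U' * diagonal (fun i => (p' i : ℂ)) * U'ᴴ)
      = V' k * diagonal (fun a => (q' k a : ℂ)) * (V' k)ᴴ := hUp' ▸ hVq'
  have key := relativeEntropy_mono hU (hkV hV) hU' (hkV hV') hp
    (q := fun x => ∏ k, q k (x k)) (fun x => Finset.prod_nonneg fun k _ => hq k _) hp'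
    (q' := fun x => ∏ k, q' k (x k)) (fun x => Finset.prod_nonneg fun k _ => hq' k _)
    (fun m hm => Finset.prod_ne_zero_iff.2 fun k _ => overlap_support hp hV hR _ _ hm k)
    (fun m hm => Finset.prod_ne_zero_iff.2 fun k _ => overlap_support hp' hV' hR' _ _ hm k)
    (fun Y => (Y ⊗ₖ (1 : Matrix (∀ k, δ k) (∀ k, δ k) ℂ)).submatrix e e)
    (by simp) (fun Y Z => by rw [submatrix_mul_equiv, ← mul_kronecker_mul, Matrix.one_mul])
    (fun Y => by rw [conjTranspose_submatrix, conjTranspose_kronecker, conjTranspose_one])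
    (fun Y => by rw [← hUp, ← hUp', hρ'_def, hlift])
    (fun Y => by rw [hkR hVq, hkR hVq', hkron, hlift])
  rw [sum_overlap_log hp hV hR, sum_overlap_log hp' hV' hR'] at key
  simp_rw [hS, hS', hT, hT', Finset.sum_neg_distrib]
  linarith

end mutualInformation

section purification

variable {κ π : Type} {α : κ → Type}

/-- The values of an assignment on the original systems. -/
def systemPart {δ : π → Type} (x : ∀ i, Sum.elim α δ i) (i : κ) : α i :=
  x (.inl i)

/-- The values of an assignment on the ancillas. -/
def ancillaPart {δ : π → Type} (x : ∀ i, Sum.elim α δ i) (k : π) : δ k :=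
  x (.inr k)

theorem exists_purifies [Fintype κ] [∀ i, Fintype (α i)] [Fintype π]
    [DecidableEq π] [Nonempty π] {ρ : Matrix (∀ i, α i) (∀ i, α i) ℂ}
    (h : ρ.PosSemidef) :
    ∃ (d : π → ℕ) (ψ : (∀ i : κ ⊕ π, Sum.elim α (fun k => Fin (d k)) i) → ℂ), Purifies ψ ρ := by
  obtain ⟨k₀⟩ := ‹Nonempty π›
  obtain ⟨m, A, hA⟩ := Matrix.posSemidef_iff_eq_sum_vecMulVec.1 h
  refine ⟨fun _ => m, fun x => if ancillaPart x = fun _ => ancillaPart x k₀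
    then A (ancillaPart x k₀) (systemPart x) else 0, fun f g => ?_⟩
  have h1 (a : π → Fin m) :
      vecState (fun x : ∀ i : κ ⊕ π, Sum.elim α (fun _ => Fin m) i =>
        if ancillaPart x = fun _ => ancillaPart x k₀
        then A (ancillaPart x k₀) (systemPart x) else 0) (mergeSum f a) (mergeSum g a)
      = if a = fun _ => a k₀ then A (a k₀) f * star (A (a k₀) g) else 0 := by
    have hs (f : ∀ i, α i) : systemPart (mergeSum f a) = f := rfl
    have ha (f : ∀ i, α i) : ancillaPart (mergeSum f a) = a := rfl
    simp only [vecState, Matrix.of_apply, hs, ha]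
    split_ifs <;> simp
  rw [Finset.sum_congr rfl fun a _ => h1 a, ← Finset.sum_filter, hA, Matrix.sum_apply]
  refine Finset.sum_nbij' (fun a => a k₀) (fun b _ => b) (by simp) (by simp) (fun a ha => ?_)
    (by simp) (by simp [Matrix.vecMulVec_apply])
  exact (Finset.mem_filter.1 ha).2.symm

end purification

section reduce

variable {κ : Type} [Fintype κ] [DecidableEq κ] {α : κ → Type} [∀ i, Fintype (α i)]
  [∀ i, DecidableEq (α i)]

theorem reduce_eq_marg (s : Finset κ) (ρ : Matrix (∀ i, α i) (∀ i, α i) ℂ) :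
    reduce s ρ = marg (fun x (i : {j // j ∈ s}) => x i) (fun x (i : {j // j ∉ s}) => x i) ρ := by
  ext f g
  exact (marg_equiv_apply (Equiv.piEquivPiSubtypeProd (· ∈ s) α) ρ f g).symm

theorem reduce_posSemidef (s : Finset κ) {ρ : Matrix (∀ i, α i) (∀ i, α i) ℂ}
    (h : ρ.PosSemidef) : (reduce s ρ).PosSemidef :=
  reduce_eq_marg s ρ ▸ marg_posSemidef _ _ h

theorem trace_reduce (s : Finset κ) (ρ : Matrix (∀ i, α i) (∀ i, α i) ℂ) :
    (reduce s ρ).trace = ρ.trace := by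
  rw [reduce_eq_marg, trace_marg]
  refine fun x y hx hy => funext fun i => ?_
  by_cases hi : i ∈ s
  · exact congrFun hx ⟨i, hi⟩
  · exact congrFun hy ⟨i, hi⟩

theorem matEntropy_reduce_singleton (k : κ) {ρ : Matrix (∀ i, α i) (∀ i, α i) ℂ}
    (h : ρ.PosSemidef) : matEntropy (reduce {k} ρ) = matEntropy (margAt k ρ) := by
  rw [reduce_eq_marg, margAt]
  refine matEntropy_marg_congr (fun x y => ?_) (fun x y => ?_) h <;> simp [funext_iff]

theorem matEntropy_reduce_reduce_singleton (s : Finset κ) (k : {j // j ∈ s})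
    {ρ : Matrix (∀ i, α i) (∀ i, α i) ℂ} (h : ρ.PosSemidef) :
    matEntropy (reduce {k} (reduce s ρ)) = matEntropy (reduce {k.1} ρ) := by
  rw [reduce_eq_marg, reduce_eq_marg, reduce_eq_marg, marg_marg]
  refine matEntropy_marg_congr (fun x y => ?_) (fun x y => ?_) h
  · simp [funext_iff]
  · simp only [Prod.mk.injEq, funext_iff, Subtype.forall, Finset.mem_singleton]
    constructor
    · rintro ⟨h1, h2⟩ i hi
      by_cases his : i ∈ s
      · exact h1 i his fun h => hi (congrArg Subtype.val h)
      · exact h2 i his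
    · intro h1
      exact ⟨fun i his hi => h1 i fun h => hi (Subtype.ext h),
        fun i his => h1 i fun h => his (h ▸ k.2)⟩

theorem matEntropy_reduce_compl (s : Finset κ) (φ : (∀ i, α i) → ℂ) :
    matEntropy (reduce sᶜ (vecState φ)) = matEntropy (reduce s (vecState φ)) := by
  rw [reduce_eq_marg, reduce_eq_marg, matEntropy_marg_vecState_swap]
  refine matEntropy_marg_congr (fun x y => ?_) (fun x y => ?_) (vecState_posSemidef φ) <;>
    simp [funext_iff]

/-- **Subadditivity** of the von Neumann entropy. -/
theorem matEntropy_le_sum_margAt {ρ : Matrix (∀ i, α i) (∀ i, α i) ℂ}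
    (h : ρ.PosSemidef) (ht : ρ.trace = 1) : matEntropy ρ ≤ ∑ k, matEntropy (margAt k ρ) := by
  let e : (∀ k, Unit × α k) ≃ ∀ k, α k := Equiv.piCongrRight fun k => Equiv.punitProd (α k)
  have hσ : (ρ.submatrix e e).PosSemidef := h.submatrix e
  have htr : (ρ.submatrix e e).trace = 1 := by
    rw [← ht]
    exact Fintype.sum_equiv e _ _ fun _ => rfl
  have key := mutualInformation_mono hσ
  set τ := marg (fun (x : ∀ k, Unit × α k) k => (x k).1) (fun x k => (x k).2) (ρ.submatrix e e)
  have hτ : τ.PosSemidef := marg_posSemidef _ _ hσ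
  have hτt : τ.trace = 1 := by
    rw [← htr]
    exact trace_marg _ _ (fun x y h1 h2 => funext fun k =>
      Prod.ext (congrFun h1 k) (congrFun h2 k)) _
  have hS : matEntropy τ = 0 := matEntropy_eq_zero_of_unique hτ.1 hτt
  have hk (k : κ) : matEntropy (margAt k τ) = 0 := by
    refine matEntropy_eq_zero_of_unique (marg_posSemidef _ _ hτ).1 ?_
    rw [margAt, trace_marg, hτt]
    exact fun x y _ _ => Subsingleton.elim x y
  have hρ : matEntropy (ρ.submatrix e e) = matEntropy ρ := by
    rw [← marg_id_unit (ρ.submatrix e e), marg_submatrix]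
    conv_rhs => rw [← marg_id_unit ρ]
    exact matEntropy_marg_congr (fun x y => by simp) (fun x y => by simp) h
  have hkρ (k : κ) : matEntropy (margAt k (ρ.submatrix e e)) = matEntropy (margAt k ρ) := by
    rw [margAt, margAt, marg_submatrix]
    refine matEntropy_marg_congr (fun x y => ?_) (fun x y => ?_) h <;>
      simp [e, funext_iff, Equiv.punitProd]
  simp only [hS, hk, hρ, hkρ, Finset.sum_const_zero, sub_zero] at key
  linarith

theorem matEntropy_reduce_le_sum (s : Finset κ) {ρ : Matrix (∀ i, α i) (∀ i, α i) ℂ}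
    (h : ρ.PosSemidef) (ht : ρ.trace = 1) :
    matEntropy (reduce s ρ) ≤ ∑ i ∈ s, matEntropy (reduce {i} ρ) := by
  refine (matEntropy_le_sum_margAt (reduce_posSemidef s h) ((trace_reduce s ρ).trans ht)).trans_eq ?_
  rw [← Finset.sum_coe_sort s]
  refine Finset.sum_congr rfl fun k _ => ?_
  rw [← matEntropy_reduce_singleton k (reduce_posSemidef s h),
    matEntropy_reduce_reduce_singleton s k h]

theorem Imulti_reduce (s : Finset κ) {ρ : Matrix (∀ i, α i) (∀ i, α i) ℂ}
    (h : ρ.PosSemidef) :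
    Imulti (reduce s ρ) = ∑ i ∈ s, matEntropy (reduce {i} ρ) - matEntropy (reduce s ρ) := by
  rw [Imulti, ← Finset.sum_coe_sort s]
  simp_rw [matEntropy_reduce_reduce_singleton s _ h]

section purification

variable {π : Type} [Fintype π] [DecidableEq π]

theorem Purifies.eq_marg {d : π → ℕ}
    {ψ : (∀ i : κ ⊕ π, Sum.elim α (fun k => Fin (d k)) i) → ℂ}
    {ρ : Matrix (∀ i, α i) (∀ i, α i) ℂ} (h : Purifies ψ ρ) :
    ρ = marg systemPart ancillaPart (vecState ψ) := by
  let e : (∀ i : κ ⊕ π, Sum.elim α (fun k => Fin (d k)) i) ≃ (∀ i, α i) × ∀ k, Fin (d k) :=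
    ⟨fun x => (systemPart x, ancillaPart x), fun y => mergeSum y.1 y.2,
      fun x => funext fun i => by cases i <;> rfl, fun _ => rfl⟩
  ext f g
  rw [← h f g]
  exact (marg_equiv_apply e _ f g).symm

theorem Purifies.trace_vecState {d : π → ℕ}
    {ψ : (∀ i : κ ⊕ π, Sum.elim α (fun k => Fin (d k)) i) → ℂ}
    {ρ : Matrix (∀ i, α i) (∀ i, α i) ℂ} (h : Purifies ψ ρ) :
    (vecState ψ).trace = ρ.trace := by
  rw [h.eq_marg, trace_marg]
  rintro x y h1 h2
  funext i
  cases i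
  exacts [congrFun h1 _, congrFun h2 _]

theorem sum_matEntropy_nonneg_of_purifies (p : κ → π) {d : π → ℕ}
    {ψ : (∀ i : κ ⊕ π, Sum.elim α (fun k => Fin (d k)) i) → ℂ}
    {ρ : Matrix (∀ i, α i) (∀ i, α i) ℂ} (h : Purifies ψ ρ) (ht : ρ.trace = 1) :
    0 ≤ ∑ k, matEntropy (reduce (partyFinset p k) (vecState ψ)) :=
  Finset.sum_nonneg fun _ _ => posSemidef_matEntropy_nonneg
    (reduce_posSemidef _ (vecState_posSemidef ψ))
    ((trace_reduce _ _).trans (h.trace_vecState.trans ht))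

theorem DeltaPart_vecState_le (p : κ → π) {φ : (∀ i, α i) → ℂ} (ht : (vecState φ).trace = 1) :
    DeltaPart p (vecState φ)
      ≤ ∑ k, matEntropy (reduce (Finset.univ.filter fun i => p i = k) (vecState φ)) := by
  let ψ : (∀ i : κ ⊕ π, Sum.elim α (fun _ => Fin 1) i) → ℂ := fun x => φ (systemPart x)
  have hψ : Purifies ψ (vecState φ) := fun f g => by
    rw [Fintype.sum_unique]
    rfl
  refine csInf_le ⟨0, ?_⟩ ⟨fun _ => 1, ψ, hψ, Finset.sum_congr rfl fun k _ => ?_⟩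
  · rintro _ ⟨d, ψ, h, rfl⟩
    exact sum_matEntropy_nonneg_of_purifies p h ht
  · conv_lhs => rw [hψ.eq_marg, reduce_eq_marg, marg_marg]
    rw [reduce_eq_marg]
    refine matEntropy_marg_congr (fun x y => ?_) (fun x y => ?_) (vecState_posSemidef ψ)
    · simp only [funext_iff, Subtype.forall]
      constructor
      · rintro h (i | l) hi
        · exact h i (by simpa [partyFinset] using hi)
        · exact Subsingleton.elim (α := Fin 1) _ _
      · exact fun h i hi => h (.inl i) (by simpa [partyFinset] using hi)
    · simp only [funext_iff, Subtype.forall, Prod.mk.injEq]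
      constructor
      · rintro ⟨h, -⟩ (i | l) hi
        · exact h i (by simpa [partyFinset] using hi)
        · exact Subsingleton.elim (α := Fin 1) _ _
      · exact fun h => ⟨fun i hi => h (.inl i) (by simpa [partyFinset] using hi),
          fun _ => Subsingleton.elim _ _⟩

end purification

theorem Imulti_le_of_purifies {d : κ → ℕ}
    {ψ : (∀ i : κ ⊕ κ, Sum.elim α (fun k => Fin (d k)) i) → ℂ}
    {ρ : Matrix (∀ i, α i) (∀ i, α i) ℂ} (h : Purifies ψ ρ) (ht : ρ.trace = 1) :
    Imulti ρ ≤ ∑ k, matEntropy (reduce (partyFinset id k) (vecState ψ)) := by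
  let e : (∀ k, α k × Fin (d k)) ≃ ∀ i : κ ⊕ κ, Sum.elim α (fun k => Fin (d k)) i :=
    ⟨fun x => mergeSum (fun k => (x k).1) fun k => (x k).2,
      fun y k => (systemPart y k, ancillaPart y k), fun _ => rfl,
      fun y => funext fun i => by cases i <;> rfl⟩
  have key := mutualInformation_mono ((vecState_posSemidef ψ).submatrix e)
  have hρ : ρ.PosSemidef := h.eq_marg ▸ marg_posSemidef _ _ (vecState_posSemidef ψ)
  have h1 : marg (fun (x : ∀ k, α k × Fin (d k)) k => (x k).1) (fun x k => (x k).2)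
      ((vecState ψ).submatrix e e) = ρ := by
    rw [marg_submatrix, h.eq_marg]
    rfl
  have h2 : matEntropy ((vecState ψ).submatrix e e) = 0 := by
    refine matEntropy_vecState (ψ := fun x => ψ (e x)) ?_
    rw [← ht, ← h.trace_vecState]
    exact Fintype.sum_equiv e _ _ fun _ => rfl
  have h3 (k : κ) : matEntropy (margAt k ((vecState ψ).submatrix e e))
      = matEntropy (reduce (partyFinset id k) (vecState ψ)) := by
    rw [margAt, marg_submatrix, reduce_eq_marg]
    refine matEntropy_marg_congr (fun x y => ?_) (fun x y => ?_) (vecState_posSemidef ψ)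
    · simp only [funext_iff, Subtype.forall]
      constructor
      · rintro h (i | i) hi
        · obtain rfl : k = i := by simpa [partyFinset] using hi
          exact congrArg Prod.fst h
        · obtain rfl : i = k := by simpa [partyFinset] using hi
          exact congrArg Prod.snd h
      · exact fun h => Prod.ext (h (.inl k) (by simp [partyFinset]))
          (h (.inr k) (by simp [partyFinset]))
    · simp only [funext_iff, Subtype.forall]
      constructor
      · rintro h (i | i) hi
        · exact congrArg Prod.fst (h i (by simpa [partyFinset, eq_comm] using hi))
        · exact congrArg Prod.snd (h i (by simpa [partyFinset] using hi))
      · exact fun h l hl => Prod.ext (h (.inl l) (by simpa [partyFinset, eq_comm] using hl))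
          (h (.inr l) (by simpa [partyFinset] using hl))
  simp only [h1, h2, h3, sub_zero] at key
  simp_rw [Imulti, matEntropy_reduce_singleton _ hρ]
  exact key

theorem Imulti_le_DeltaPart [Nonempty κ] {ρ : Matrix (∀ i, α i) (∀ i, α i) ℂ} (h : ρ.PosSemidef)
    (ht : ρ.trace = 1) : Imulti ρ ≤ DeltaPart id ρ := by
  refine le_csInf ?_ ?_
  · obtain ⟨d, ψ, hψ⟩ := exists_purifies (π := κ) h
    exact ⟨_, d, ψ, hψ, rfl⟩
  · rintro _ ⟨d, ψ, hψ, rfl⟩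
    exact Imulti_le_of_purifies hψ ht

theorem sum_sub_le_DeltaPart_reduce_compl [Nontrivial κ] (c : κ) {φ : (∀ i, α i) → ℂ}
    (ht : (vecState φ).trace = 1) :
    ∑ i, matEntropy (reduce {i} (vecState φ)) - 2 * matEntropy (reduce {c} (vecState φ))
      ≤ DeltaPart id (reduce {c}ᶜ (vecState φ)) := by
  obtain ⟨b, hb⟩ := exists_ne c
  have : Nonempty {j // j ∈ ({c}ᶜ : Finset κ)} := ⟨⟨b, by simpa using hb⟩⟩
  refine le_trans (le_of_eq ?_) (Imulti_le_DeltaPart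
    (reduce_posSemidef _ (vecState_posSemidef φ)) ((trace_reduce _ _).trans ht))
  rw [Imulti_reduce _ (vecState_posSemidef φ), matEntropy_reduce_compl,
    Fintype.sum_eq_add_sum_compl c]
  ring

end reduce

/-- polygamy of `Δ_P` for pure states:
`Δ_P(A₁:⋯:Aₙ:BC) ≤ Δ_P(A₁:⋯:Aₙ:B) + Δ_P(A₁:⋯:Aₙ:C)` for a pure state on
`A₁⋯AₙBC`.  The subsystems are indexed by `Fin (n+2)`: parties `A₁,…,Aₙ` are
`0,…,n−1`, `B` is `n` and `C` is `n+1`.  On the left, `B` and `C` are grouped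
into one party (the partition sends subsystem `i` to `min i n`); on the right,
`C` (resp. `B`) has been traced out. -/
theorem DeltaP_polygamy_pure {n : ℕ} {α : Fin (n + 2) → Type}
    [∀ i, Fintype (α i)] [∀ i, DecidableEq (α i)]
    (φ : (∀ i, α i) → ℂ) (hρ : IsDensityMatrix (vecState φ)) :
    DeltaPart
        (fun i : Fin (n + 2) =>
          (⟨min (i : ℕ) n, Nat.lt_succ_of_le (Nat.min_le_right _ _)⟩ : Fin (n + 1)))
        (vecState φ)
    ≤ DeltaPart id
        (reduce (({(⟨n + 1, by omega⟩ : Fin (n + 2))} : Finset (Fin (n + 2)))ᶜ) (vecState φ))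
      + DeltaPart id
        (reduce (({(⟨n, by omega⟩ : Fin (n + 2))} : Finset (Fin (n + 2)))ᶜ) (vecState φ)) := by
  obtain ⟨-, ht⟩ := hρ
  have hφ : (vecState φ).PosSemidef := vecState_posSemidef φ
  set B : Fin (n + 2) := ⟨n, by omega⟩ with hB
  set C : Fin (n + 2) := ⟨n + 1, by omega⟩ with hC
  have hBC : B ≠ C := by simp [hB, hC]
  have hL := DeltaPart_vecState_le (fun i : Fin (n + 2) =>
    (⟨min (i : ℕ) n, Nat.lt_succ_of_le (Nat.min_le_right _ _)⟩ : Fin (n + 1))) ht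
  have hsum : ∑ i, matEntropy (reduce {i} (vecState φ))
      = ∑ k : Fin n, matEntropy (reduce {k.castSucc.castSucc} (vecState φ))
        + matEntropy (reduce {B} (vecState φ)) + matEntropy (reduce {C} (vecState φ)) := by
    rw [Fin.sum_univ_castSucc, Fin.sum_univ_castSucc]
    rfl
  have hsub : matEntropy (reduce {B, C} (vecState φ))
      ≤ ∑ k : Fin n, matEntropy (reduce {k.castSucc.castSucc} (vecState φ)) := by
    rw [← matEntropy_reduce_compl]
    refine (matEntropy_reduce_le_sum _ hφ ht).trans_eq ?_
    have h := Finset.sum_compl_add_sum {B, C} fun i => matEntropy (reduce {i} (vecState φ))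
    rw [Finset.sum_pair hBC, hsum] at h
    linarith
  have hparty (k : Fin n) : (Finset.univ.filter fun i : Fin (n + 2) =>
      (⟨min (i : ℕ) n, Nat.lt_succ_of_le (Nat.min_le_right _ _)⟩ : Fin (n + 1)) = k.castSucc)
      = {k.castSucc.castSucc} := by
    ext i
    simp only [Finset.mem_filter, Finset.mem_univ, true_and, Finset.mem_singleton, Fin.ext_iff,
      Fin.val_castSucc]
    omega
  have hlast : (Finset.univ.filter fun i : Fin (n + 2) =>
      (⟨min (i : ℕ) n, Nat.lt_succ_of_le (Nat.min_le_right _ _)⟩ : Fin (n + 1)) = Fin.last n)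
      = {B, C} := by
    ext i
    simp only [Finset.mem_filter, Finset.mem_univ, true_and, Finset.mem_singleton,
      Finset.mem_insert, Fin.ext_iff, Fin.val_last, hB, hC]
    omega
  rw [Fin.sum_univ_castSucc, hlast, Finset.sum_congr rfl fun k _ => by rw [hparty k]] at hL
  have hRB := sum_sub_le_DeltaPart_reduce_compl C ht
  have hRC := sum_sub_le_DeltaPart_reduce_compl B ht
  rw [hsum] at hRB hRC
  linarith
end
end

section
/- If a tripartite state ρ_{ABC} saturates both strong subadditivity inequalities S_A + S_C = S_{AB} + S_{BC} and S_B + S_C = S_{AB} + S_{AC}, then Δ_P(A:B:C) = S_A + S_B + S_{AB}. -/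
open scoped BigOperators ComplexOrder

noncomputable section

section RelativeEntropy

open Matrix Filter Topology Kronecker

variable {n I J : Type} [Fintype n] [DecidableEq n] [Fintype I] [DecidableEq I]
  [Fintype J] [DecidableEq J]

/-- The quadratic functional of `X` whose supremum is `⟨ρ, (L_σ + t R_ρ)⁻¹ ρ⟩`. -/
def relForm (ρ σ X : Matrix n n ℂ) (t : ℝ) : ℝ :=
  2 * (ρ * Xᴴ).trace.re - (σ * (X * Xᴴ)).trace.re - t * (ρ * (Xᴴ * X)).trace.re

/-- `⟨ρ, (L_σ + t R_ρ)⁻¹ ρ⟩` for `ρ = U diag(p) Uᴴ` and `σ = V diag(q) Vᴴ`. -/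
def resolventSum (U : Matrix n I ℂ) (p : I → ℝ) (V : Matrix n J ℂ) (q : J → ℝ) (t : ℝ) : ℝ :=
  ∑ j, ∑ i, ‖(Vᴴ * U) j i‖ ^ 2 * (p i ^ 2 / (q j + t * p i))

/-- The matrix `U diag(p) Uᴴ`. -/
def conjDiag (U : Matrix n I ℂ) (p : I → ℝ) : Matrix n n ℂ :=
  U * diagonal (fun i => (p i : ℂ)) * Uᴴ

omit [DecidableEq n] in
lemma relForm_conjDiag (U : Matrix n I ℂ) (p : I → ℝ) (V : Matrix n J ℂ) (q : J → ℝ)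
    (hU : Uᴴ * U = 1) (hV : Vᴴ * V = 1) (Y : Matrix J I ℂ) (t : ℝ) :
    relForm (conjDiag U p) (conjDiag V q) (V * Y * Uᴴ) t =
      ∑ j, ∑ i, (2 * p i * ((Vᴴ * U) j i * star (Y j i)).re
        - (q j + t * p i) * ‖Y j i‖ ^ 2) := by
  have e1 : (conjDiag U p * (V * Y * Uᴴ)ᴴ).trace =
      ∑ j, ∑ i, (p i : ℂ) * ((Vᴴ * U) j i * star (Y j i)) := by
    have : conjDiag U p * (V * Y * Uᴴ)ᴴ
        = U * (diagonal (fun i => (p i : ℂ)) * ((Uᴴ * U) * (Yᴴ * Vᴴ))) := by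
      simp only [conjDiag, conjTranspose_mul, conjTranspose_conjTranspose, Matrix.mul_assoc]
    rw [this, hU, Matrix.one_mul, trace_mul_comm, Matrix.mul_assoc, Matrix.mul_assoc,
      Matrix.trace]
    simp only [diag_apply, diagonal_mul]
    rw [Finset.sum_comm]
    refine Finset.sum_congr rfl fun i _ => ?_
    rw [Matrix.mul_apply, Finset.mul_sum]
    refine Finset.sum_congr rfl fun j _ => ?_
    rw [conjTranspose_apply]; ring
  have e2 : (conjDiag V q * ((V * Y * Uᴴ) * (V * Y * Uᴴ)ᴴ)).trace =
      ∑ j, ∑ i, (q j : ℂ) * (Y j i * star (Y j i)) := by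
    have : conjDiag V q * ((V * Y * Uᴴ) * (V * Y * Uᴴ)ᴴ)
        = V * (diagonal (fun i => (q i : ℂ)) * ((Vᴴ * V) * (Y * ((Uᴴ * U) * (Yᴴ * Vᴴ))))) := by
      simp only [conjDiag, conjTranspose_mul, conjTranspose_conjTranspose, Matrix.mul_assoc]
    rw [this, hU, hV, Matrix.one_mul, Matrix.one_mul, trace_mul_comm]
    have : diagonal (fun i => (q i : ℂ)) * (Y * (Yᴴ * Vᴴ)) * V
        = diagonal (fun i => (q i : ℂ)) * (Y * (Yᴴ * (Vᴴ * V))) := by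
      simp only [Matrix.mul_assoc]
    rw [this, hV, Matrix.mul_one, Matrix.trace]
    simp only [diag_apply, diagonal_mul]
    refine Finset.sum_congr rfl fun i _ => ?_
    rw [Matrix.mul_apply, Finset.mul_sum]
    refine Finset.sum_congr rfl fun j _ => ?_
    rw [conjTranspose_apply]
  have e3 : (conjDiag U p * ((V * Y * Uᴴ)ᴴ * (V * Y * Uᴴ))).trace =
      ∑ j, ∑ i, (p i : ℂ) * (Y j i * star (Y j i)) := by
    have : conjDiag U p * ((V * Y * Uᴴ)ᴴ * (V * Y * Uᴴ))
        = U * (diagonal (fun i => (p i : ℂ)) * ((Uᴴ * U) * (Yᴴ * ((Vᴴ * V) * (Y * Uᴴ))))) := by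
      simp only [conjDiag, conjTranspose_mul, conjTranspose_conjTranspose, Matrix.mul_assoc]
    rw [this, hU, hV, Matrix.one_mul, Matrix.one_mul, trace_mul_comm]
    have : diagonal (fun i => (p i : ℂ)) * (Yᴴ * (Y * Uᴴ)) * U
        = diagonal (fun i => (p i : ℂ)) * (Yᴴ * (Y * (Uᴴ * U))) := by
      simp only [Matrix.mul_assoc]
    rw [this, hU, Matrix.mul_one, Matrix.trace]
    simp only [diag_apply, diagonal_mul]
    rw [Finset.sum_comm]
    refine Finset.sum_congr rfl fun i _ => ?_
    rw [Matrix.mul_apply, Finset.mul_sum]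
    refine Finset.sum_congr rfl fun j _ => ?_
    rw [conjTranspose_apply]; ring
  have hn : ∀ z : ℂ, z * star z = ((‖z‖ ^ 2 : ℝ) : ℂ) := fun z => by
    rw [Complex.star_def, Complex.mul_conj, Complex.normSq_eq_norm_sq]
  rw [relForm, e1, e2, e3]
  simp only [hn, Complex.re_sum, Complex.re_ofReal_mul, Complex.ofReal_re, Finset.mul_sum,
    ← Finset.sum_sub_distrib]
  refine Finset.sum_congr rfl fun j _ => Finset.sum_congr rfl fun i _ => ?_
  ring

lemma two_mul_re_sub_le_s14 (w y : ℂ) (p : ℝ) {c : ℝ} (hc : 0 < c) :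
    2 * p * (w * star y).re - c * ‖y‖ ^ 2 ≤ ‖w‖ ^ 2 * (p ^ 2 / c) := by
  rw [← mul_div_assoc, le_div_iff₀ hc]
  simp only [← Complex.normSq_eq_norm_sq, Complex.normSq_apply, Complex.star_def, Complex.mul_re,
    Complex.conj_re, Complex.conj_im]
  nlinarith [sq_nonneg (p * w.re - c * y.re), sq_nonneg (p * w.im - c * y.im)]

lemma relForm_le_resolventSum (U : Matrix n I ℂ) (p : I → ℝ) (V : Matrix n J ℂ) (q : J → ℝ)
    (hU : Uᴴ * U = 1) (hU' : U * Uᴴ = 1) (hV : Vᴴ * V = 1) (hV' : V * Vᴴ = 1)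
    {t : ℝ} (h : ∀ j i, 0 < q j + t * p i) (X : Matrix n n ℂ) :
    relForm (conjDiag U p) (conjDiag V q) X t ≤ resolventSum U p V q t := by
  have hX : X = V * (Vᴴ * X * U) * Uᴴ := by
    have : V * (Vᴴ * X * U) * Uᴴ = (V * Vᴴ) * X * (U * Uᴴ) := by simp only [Matrix.mul_assoc]
    rw [this, hU', hV', Matrix.one_mul, Matrix.mul_one]
  rw [hX, relForm_conjDiag U p V q hU hV]
  exact Finset.sum_le_sum fun j _ => Finset.sum_le_sum fun i _ => two_mul_re_sub_le_s14 _ _ _ (h j i)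

lemma exists_relForm_eq_resolventSum (U : Matrix n I ℂ) (p : I → ℝ) (V : Matrix n J ℂ)
    (q : J → ℝ) (hU : Uᴴ * U = 1) (hV : Vᴴ * V = 1)
    {t : ℝ} (h : ∀ j i, 0 < q j + t * p i) :
    ∃ X, relForm (conjDiag U p) (conjDiag V q) X t = resolventSum U p V q t := by
  refine ⟨V * (Matrix.of fun j i => ((p i / (q j + t * p i) : ℝ) : ℂ) * (Vᴴ * U) j i) * Uᴴ, ?_⟩
  rw [relForm_conjDiag U p V q hU hV]
  refine Finset.sum_congr rfl fun j _ => Finset.sum_congr rfl fun i _ => ?_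
  have hc := h j i
  simp only [of_apply]
  generalize (Vᴴ * U) j i = w
  generalize q j + t * p i = c at *
  simp only [← Complex.normSq_eq_norm_sq, Complex.normSq_apply, Complex.star_def, Complex.mul_re,
    Complex.mul_im, Complex.conj_re, Complex.conj_im, Complex.ofReal_re, Complex.ofReal_im]
  field_simp
  ring

/-- Partial trace over the second tensor factor. -/
def ptrace {K E : Type} [Fintype E] (M : Matrix (K × E) (K × E) ℂ) : Matrix K K ℂ :=
  Matrix.of fun k l => ∑ e, M (k, e) (l, e)

lemma trace_mul_kronecker_one {K E : Type} [Fintype K] [Fintype E] [DecidableEq E]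
    (M : Matrix (K × E) (K × E) ℂ) (Y : Matrix K K ℂ) :
    (M * (Y ⊗ₖ (1 : Matrix E E ℂ))).trace = (ptrace M * Y).trace := by
  simp only [Matrix.trace, diag_apply, Matrix.mul_apply, ptrace, of_apply, kroneckerMap_apply,
    Fintype.sum_prod_type, Matrix.one_apply, mul_ite, mul_one, mul_zero, Finset.sum_ite_eq',
    Finset.mem_univ, if_true, Finset.sum_mul]
  exact Finset.sum_congr rfl fun k _ => Finset.sum_comm

lemma relForm_kronecker_one {K E : Type} [Fintype K] [DecidableEq K] [Fintype E] [DecidableEq E]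
    (ρ σ : Matrix (K × E) (K × E) ℂ) (X : Matrix K K ℂ) (t : ℝ) :
    relForm ρ σ (X ⊗ₖ (1 : Matrix E E ℂ)) t = relForm (ptrace ρ) (ptrace σ) X t := by
  simp only [relForm, conjTranspose_kronecker, conjTranspose_one, ← mul_kronecker_mul, Matrix.mul_one,
    trace_mul_kronecker_one]

/-- Regularised relative entropy; its `t`-derivative is `resolventSum`. -/
def logSum (U : Matrix n I ℂ) (p : I → ℝ) (V : Matrix n J ℂ) (q : J → ℝ) (t : ℝ) : ℝ :=
  ∑ j, ∑ i, ‖(Vᴴ * U) j i‖ ^ 2 * (p i * (Real.log (q j + t * p i) - Real.log (q j)))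

omit [DecidableEq n] [DecidableEq I] [DecidableEq J] in
lemma hasDerivAt_logSum (U : Matrix n I ℂ) (p : I → ℝ) (V : Matrix n J ℂ) (q : J → ℝ)
    {t : ℝ} (h : ∀ j i, 0 < q j + t * p i) :
    HasDerivAt (logSum U p V q) (resolventSum U p V q t) t := by
  refine HasDerivAt.fun_sum fun j _ => HasDerivAt.fun_sum fun i _ => HasDerivAt.const_mul _ ?_
  have h1 : HasDerivAt (fun t : ℝ => q j + t * p i) (p i) t := by
    simpa using ((hasDerivAt_id t).mul_const (p i)).const_add (q j)
  convert ((h1.log (h j i).ne').sub_const (Real.log (q j))).const_mul (p i) using 1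
  ring

omit [Fintype I] [DecidableEq J] in
lemma sum_norm_sq_col (U : Matrix n I ℂ) (V : Matrix n J ℂ) (hU : Uᴴ * U = 1)
    (hV' : V * Vᴴ = 1) (i : I) : ∑ j, ‖(Vᴴ * U) j i‖ ^ 2 = 1 := by
  have : ((Vᴴ * U)ᴴ * (Vᴴ * U)) i i = 1 := by
    have : (Vᴴ * U)ᴴ * (Vᴴ * U) = Uᴴ * ((V * Vᴴ) * U) := by
      simp only [conjTranspose_mul, conjTranspose_conjTranspose, Matrix.mul_assoc]
    rw [this, hV', Matrix.one_mul, hU, Matrix.one_apply_eq]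
  rw [Matrix.mul_apply] at this
  have h2 : ((∑ j, ‖(Vᴴ * U) j i‖ ^ 2 : ℝ) : ℂ) = 1 := by
    rw [← this]
    push_cast
    refine Finset.sum_congr rfl fun j _ => ?_
    rw [conjTranspose_apply, Complex.star_def, mul_comm, Complex.mul_conj,
      Complex.normSq_eq_norm_sq]
    push_cast; rfl
  exact_mod_cast h2

lemma tendsto_logSum (U : Matrix n I ℂ) (p : I → ℝ) (V : Matrix n J ℂ) (q : J → ℝ)
    (hU : Uᴴ * U = 1) (hV' : V * Vᴴ = 1) (hp : ∀ i, 0 ≤ p i) (hq : ∀ j, 0 < q j) :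
    Tendsto (fun t => logSum U p V q t - (∑ i, p i) * Real.log t) atTop
      (𝓝 (∑ j, ∑ i, ‖(Vᴴ * U) j i‖ ^ 2 * (p i * (Real.log (p i) - Real.log (q j))))) := by
  have key : ∀ᶠ t : ℝ in atTop, ∑ j, ∑ i, ‖(Vᴴ * U) j i‖ ^ 2 *
      (p i * (Real.log (q j * t⁻¹ + p i) - Real.log (q j)))
      = logSum U p V q t - (∑ i, p i) * Real.log t := by
    filter_upwards [eventually_gt_atTop 0] with t ht
    have : (∑ i, p i) * Real.log t = ∑ j, ∑ i, ‖(Vᴴ * U) j i‖ ^ 2 * (p i * Real.log t) := by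
      rw [Finset.sum_comm]
      simp only [← Finset.sum_mul, sum_norm_sq_col U V hU hV', one_mul]
    rw [this, logSum]
    simp only [← Finset.sum_sub_distrib]
    refine Finset.sum_congr rfl fun j _ => Finset.sum_congr rfl fun i _ => ?_
    have h0 : 0 < q j + t * p i := by have := hq j; have := mul_nonneg ht.le (hp i); linarith
    have : q j * t⁻¹ + p i = (q j + t * p i) / t := by field_simp
    rw [this, Real.log_div h0.ne' ht.ne']
    ring
  refine Tendsto.congr' key ?_
  refine tendsto_finsetSum _ fun j _ => tendsto_finsetSum _ fun i _ => Tendsto.const_mul _ ?_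
  rcases (hp i).eq_or_lt with h | h
  · simp [← h]
  · refine Tendsto.const_mul _ (Tendsto.sub_const (Tendsto.log ?_ h.ne') _)
    simpa using (tendsto_inv_atTop_zero.const_mul (q j)).add_const (p i)

/-- Monotonicity of the relative entropy under partial trace. -/
theorem relEntropy_ptrace_le {K E I J I' J' : Type} [Fintype K] [DecidableEq K] [Fintype E]
    [DecidableEq E] [Fintype I] [DecidableEq I] [Fintype J] [DecidableEq J]
    [Fintype I'] [DecidableEq I'] [Fintype J'] [DecidableEq J']
    (U : Matrix (K × E) I ℂ) (p : I → ℝ) (V : Matrix (K × E) J ℂ) (q : J → ℝ)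
    (hU : Uᴴ * U = 1) (hU' : U * Uᴴ = 1) (hV : Vᴴ * V = 1) (hV' : V * Vᴴ = 1)
    (U₁ : Matrix K I' ℂ) (p₁ : I' → ℝ) (V₁ : Matrix K J' ℂ) (q₁ : J' → ℝ)
    (hU₁ : U₁ᴴ * U₁ = 1) (hV₁ : V₁ᴴ * V₁ = 1) (hV₁' : V₁ * V₁ᴴ = 1)
    (hp : ∀ i, 0 ≤ p i) (hq : ∀ j, 0 < q j) (hp₁ : ∀ i, 0 ≤ p₁ i) (hq₁ : ∀ j, 0 < q₁ j)
    (hρ : ptrace (conjDiag U p) = conjDiag U₁ p₁) (hσ : ptrace (conjDiag V q) = conjDiag V₁ q₁)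
    (hs : ∑ i, p i = ∑ i, p₁ i) :
    ∑ j, ∑ i, ‖(V₁ᴴ * U₁) j i‖ ^ 2 * (p₁ i * (Real.log (p₁ i) - Real.log (q₁ j)))
      ≤ ∑ j, ∑ i, ‖(Vᴴ * U) j i‖ ^ 2 * (p i * (Real.log (p i) - Real.log (q j))) := by
  have pos : ∀ t : ℝ, 0 ≤ t → ∀ j i, 0 < q j + t * p i := fun t ht j i =>
    add_pos_of_pos_of_nonneg (hq j) (mul_nonneg ht (hp i))
  have pos₁ : ∀ t : ℝ, 0 ≤ t → ∀ j i, 0 < q₁ j + t * p₁ i := fun t ht j i =>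
    add_pos_of_pos_of_nonneg (hq₁ j) (mul_nonneg ht (hp₁ i))
  have hres : ∀ t : ℝ, 0 ≤ t → resolventSum U₁ p₁ V₁ q₁ t ≤ resolventSum U p V q t := by
    intro t ht
    obtain ⟨X, hX⟩ := exists_relForm_eq_resolventSum U₁ p₁ V₁ q₁ hU₁ hV₁ (pos₁ t ht)
    rw [← hX, ← hρ, ← hσ, ← relForm_kronecker_one]
    exact relForm_le_resolventSum U p V q hU hU' hV hV' (pos t ht) _
  have hder : ∀ t : ℝ, 0 ≤ t → HasDerivAt (fun t => logSum U p V q t - logSum U₁ p₁ V₁ q₁ t)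
      (resolventSum U p V q t - resolventSum U₁ p₁ V₁ q₁ t) t := fun t ht =>
    (hasDerivAt_logSum U p V q (pos t ht)).sub (hasDerivAt_logSum U₁ p₁ V₁ q₁ (pos₁ t ht))
  have hmono : MonotoneOn (fun t => logSum U p V q t - logSum U₁ p₁ V₁ q₁ t) (Set.Ici 0) := by
    refine monotoneOn_of_deriv_nonneg (convex_Ici 0)
      (fun t ht => (hder t ht).continuousAt.continuousWithinAt) ?_ ?_
    · intro t ht
      rw [interior_Ici] at ht
      exact (hder t (le_of_lt ht)).differentiableAt.differentiableWithinAt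
    · intro t ht
      rw [interior_Ici] at ht
      rw [(hder t (le_of_lt ht)).deriv]
      exact sub_nonneg.2 (hres t (le_of_lt ht))
  refine le_of_tendsto_of_tendsto (tendsto_logSum U₁ p₁ V₁ q₁ hU₁ hV₁' hp₁ hq₁)
    (tendsto_logSum U p V q hU hV' hp hq) ?_
  filter_upwards [eventually_ge_atTop 0] with t ht
  have := hmono (Set.mem_Ici.2 le_rfl) (Set.mem_Ici.2 ht) ht
  simp only [logSum, zero_mul, add_zero, sub_self, mul_zero, Finset.sum_const_zero] at this
  rw [hs]
  exact sub_le_sub_right (sub_nonneg.1 this) _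

end RelativeEntropy

section MutualInformation

open Matrix Filter Topology Kronecker

/-- Partial trace over the first tensor factor. -/
def ptraceLeft {K E : Type} [Fintype K] (M : Matrix (K × E) (K × E) ℂ) : Matrix E E ℂ :=
  Matrix.of fun e f => ∑ k, M (k, e) (k, f)

lemma posSemidef_ptrace {K E : Type} [Fintype E]
    {M : Matrix (K × E) (K × E) ℂ} (hM : M.PosSemidef) : (ptrace M).PosSemidef := by
  have : ptrace M = ∑ e, M.submatrix (fun k => (k, e)) (fun k => (k, e)) := by
    ext k l; simp [ptrace, Matrix.sum_apply]
  rw [this]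
  exact Matrix.posSemidef_sum _ fun e _ => hM.submatrix _

lemma posSemidef_ptraceLeft {K E : Type} [Fintype K]
    {M : Matrix (K × E) (K × E) ℂ} (hM : M.PosSemidef) : (ptraceLeft M).PosSemidef := by
  have : ptraceLeft M = ∑ k, M.submatrix (fun e => (k, e)) (fun e => (k, e)) := by
    ext k l; simp [ptraceLeft, Matrix.sum_apply]
  rw [this]
  exact Matrix.posSemidef_sum _ fun e _ => hM.submatrix _

lemma trace_ptrace {K E : Type} [Fintype K] [Fintype E] (M : Matrix (K × E) (K × E) ℂ) :
    (ptrace M).trace = M.trace := by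
  simp [Matrix.trace, ptrace, Fintype.sum_prod_type]

lemma exists_eq_conjDiag {n : Type} [Fintype n] [DecidableEq n] {ρ : Matrix n n ℂ}
    (h : ρ.PosSemidef) : ∃ (U : Matrix n n ℂ) (p : n → ℝ), Uᴴ * U = 1 ∧ U * Uᴴ = 1 ∧
      ρ = conjDiag U p ∧ (∀ i, 0 ≤ p i) ∧ matEntropy ρ = ∑ i, Real.negMulLog (p i) := by
  refine ⟨h.1.eigenvectorUnitary, h.1.eigenvalues, ?_, ?_, ?_, h.eigenvalues_nonneg, ?_⟩
  · exact (Matrix.mem_unitaryGroup_iff' (A := (h.1.eigenvectorUnitary : Matrix n n ℂ))).1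
      h.1.eigenvectorUnitary.2
  · exact (Matrix.mem_unitaryGroup_iff (A := (h.1.eigenvectorUnitary : Matrix n n ℂ))).1
      h.1.eigenvectorUnitary.2
  · exact h.1.spectral_theorem
  · rw [matEntropy, dif_pos h.1]

lemma trace_conjDiag {n I : Type} [Fintype n] [Fintype I] [DecidableEq I]
    (U : Matrix n I ℂ) (p : I → ℝ) (hU : Uᴴ * U = 1) :
    (conjDiag U p).trace = ((∑ i, p i : ℝ) : ℂ) := by
  rw [conjDiag, trace_mul_comm, ← Matrix.mul_assoc, hU, Matrix.one_mul, trace_diagonal]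
  push_cast; rfl

lemma conjDiag_add_const {n I : Type} [DecidableEq n] [Fintype I] [DecidableEq I]
    (U : Matrix n I ℂ) (p : I → ℝ) (hU' : U * Uᴴ = 1) (c : ℝ) :
    conjDiag U (fun i => p i + c) = conjDiag U p + (c : ℂ) • (1 : Matrix n n ℂ) := by
  have : diagonal (fun i => ((p i + c : ℝ) : ℂ))
      = diagonal (fun i => (p i : ℂ)) + (c : ℂ) • (1 : Matrix I I ℂ) := by
    ext i j
    by_cases h : i = j
    · subst h; simp
    · simp [h]
  rw [conjDiag, this, Matrix.mul_add, Matrix.add_mul, Matrix.mul_smul, Matrix.mul_one,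
    Matrix.smul_mul, hU', conjDiag]

lemma conjDiag_kronecker {m n I J : Type} [Fintype I] [DecidableEq I] [Fintype J] [DecidableEq J]
    (U : Matrix m I ℂ) (p : I → ℝ) (V : Matrix n J ℂ) (q : J → ℝ) :
    conjDiag U p ⊗ₖ conjDiag V q = conjDiag (U ⊗ₖ V) (fun ij => p ij.1 * q ij.2) := by
  simp only [conjDiag, mul_kronecker_mul, conjTranspose_kronecker, diagonal_kronecker_diagonal,
    Complex.ofReal_mul]

lemma conjDiag_submatrix {m n I : Type} [Fintype I] [DecidableEq I]
    (U : Matrix n I ℂ) (p : I → ℝ) (e : m → n) :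
    conjDiag (U.submatrix e id) p = (conjDiag U p).submatrix e e := by
  ext i j
  simp [conjDiag, Matrix.mul_apply]

lemma sum_norm_sq_mul {n I J : Type} [Fintype n] [Fintype I] [DecidableEq I]
    (U : Matrix n I ℂ) (p : I → ℝ) (V : Matrix n J ℂ) (j : J) :
    ∑ i, ‖(Vᴴ * U) j i‖ ^ 2 * p i = ((Vᴴ * conjDiag U p * V) j j).re := by
  have : Vᴴ * conjDiag U p * V = (Vᴴ * U) * (diagonal (fun i => (p i : ℂ)) * (Vᴴ * U)ᴴ) := by
    simp only [conjDiag, conjTranspose_mul, conjTranspose_conjTranspose, Matrix.mul_assoc]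
  rw [this, Matrix.mul_apply, Complex.re_sum]
  refine Finset.sum_congr rfl fun i _ => ?_
  rw [diagonal_mul, conjTranspose_apply, mul_left_comm, Complex.star_def, Complex.mul_conj,
    Complex.normSq_eq_norm_sq, ← Complex.ofReal_mul, Complex.ofReal_re, mul_comm]

lemma conjTranspose_mul_conjDiag_mul {n I : Type} [Fintype n] [Fintype I] [DecidableEq I]
    (U : Matrix n I ℂ) (p : I → ℝ) (hU : Uᴴ * U = 1) (i : I) :
    ((Uᴴ * conjDiag U p * U) i i).re = p i := by
  have : Uᴴ * conjDiag U p * U = (Uᴴ * U) * (diagonal (fun i => (p i : ℂ)) * (Uᴴ * U)) := by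
    simp only [conjDiag, Matrix.mul_assoc]
  rw [this, hU, Matrix.one_mul, Matrix.mul_one, diagonal_apply_eq, Complex.ofReal_re]

lemma sum_kronecker_conj_apply_right {P Q I J : Type} [Fintype P] [Fintype Q] [DecidableEq Q]
    [Fintype J] (M : Matrix (P × Q) (P × Q) ℂ) (V : Matrix P I ℂ) (W : Matrix Q J ℂ)
    (hW' : W * Wᴴ = 1) (i : I) :
    ∑ j, ((V ⊗ₖ W)ᴴ * M * (V ⊗ₖ W)) (i, j) (i, j) = (Vᴴ * ptrace M * V) i i := by
  have hW : ∀ q q', ∑ j, W q j * star (W q' j) = if q = q' then 1 else 0 := fun q q' => by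
    have := congrFun (congrFun hW' q) q'
    simpa [Matrix.mul_apply, Matrix.one_apply] using this
  have h1 : ∀ j, ((V ⊗ₖ W)ᴴ * M * (V ⊗ₖ W)) (i, j) (i, j) =
      ∑ p, ∑ q, ∑ p', ∑ q', star (V p' i) * M (p', q') (p, q) * V p i *
        (W q j * star (W q' j)) := by
    intro j
    simp only [Matrix.mul_apply, conjTranspose_apply, kroneckerMap_apply, Fintype.sum_prod_type,
      Finset.sum_mul, star_mul']
    refine Finset.sum_congr rfl fun p _ => Finset.sum_congr rfl fun q _ =>
      Finset.sum_congr rfl fun p' _ => Finset.sum_congr rfl fun q' _ => ?_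
    ring
  simp only [h1]
  rw [Finset.sum_comm]
  simp only [Matrix.mul_apply, conjTranspose_apply, Finset.sum_mul]
  refine Finset.sum_congr rfl fun p _ => ?_
  rw [Finset.sum_comm]
  have h2 : ∀ q, ∑ j, ∑ p', ∑ q', star (V p' i) * M (p', q') (p, q) * V p i *
        (W q j * star (W q' j)) = ∑ p', star (V p' i) * M (p', q) (p, q) * V p i := by
    intro q
    rw [Finset.sum_comm]
    refine Finset.sum_congr rfl fun p' _ => ?_
    rw [Finset.sum_comm]
    simp only [← Finset.mul_sum, hW, mul_ite, mul_one, mul_zero, Finset.sum_ite_eq,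
      Finset.mem_univ, if_true]
  simp only [h2]
  rw [Finset.sum_comm]
  simp only [ptrace, of_apply, Finset.mul_sum, Finset.sum_mul]

lemma sum_kronecker_conj_apply_left {P Q I J : Type} [Fintype P] [Fintype Q] [DecidableEq P]
    [Fintype I] (M : Matrix (P × Q) (P × Q) ℂ) (V : Matrix P I ℂ) (W : Matrix Q J ℂ)
    (hV' : V * Vᴴ = 1) (j : J) :
    ∑ i, ((V ⊗ₖ W)ᴴ * M * (V ⊗ₖ W)) (i, j) (i, j) = (Wᴴ * ptraceLeft M * W) j j := by
  have h := sum_kronecker_conj_apply_right (M.submatrix Prod.swap Prod.swap) W V hV' j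
  have h2 : ptrace (M.submatrix Prod.swap Prod.swap) = ptraceLeft M := rfl
  rw [h2] at h
  rw [← h]
  refine Finset.sum_congr rfl fun i _ => ?_
  have h3 : W ⊗ₖ V = (V ⊗ₖ W).submatrix (Equiv.prodComm Q P) (Equiv.prodComm J I) := by
    ext a b; simp [kroneckerMap_apply, mul_comm]
  have h4 : M.submatrix Prod.swap Prod.swap
      = M.submatrix (Equiv.prodComm Q P) (Equiv.prodComm Q P) := rfl
  rw [h3, h4, conjTranspose_submatrix, submatrix_mul_equiv, submatrix_mul_equiv]
  rfl

/-- Relative entropy of `ρ` with respect to a regularised product of its marginals. -/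
lemma relEntropy_kronecker_eq {P Q I J K : Type} [Fintype P] [DecidableEq P] [Fintype Q]
    [DecidableEq Q] [Fintype I] [DecidableEq I] [Fintype J] [DecidableEq J] [Fintype K]
    [DecidableEq K] (U : Matrix (P × Q) K ℂ) (p : K → ℝ) (V : Matrix P I ℂ) (r : I → ℝ)
    (W : Matrix Q J ℂ) (s : J → ℝ) (hU : Uᴴ * U = 1)
    (hV : Vᴴ * V = 1) (hV' : V * Vᴴ = 1) (hW : Wᴴ * W = 1) (hW' : W * Wᴴ = 1)
    (hr : ptrace (conjDiag U p) = conjDiag V r) (hs : ptraceLeft (conjDiag U p) = conjDiag W s)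
    (f : I → ℝ) (g : J → ℝ) (hf : ∀ i, 0 < f i) (hg : ∀ j, 0 < g j) :
    ∑ j, ∑ i, ‖((V ⊗ₖ W)ᴴ * U) j i‖ ^ 2 *
      (p i * (Real.log (p i) - Real.log (f j.1 * g j.2))) =
    -(∑ i, Real.negMulLog (p i)) - ∑ i, r i * Real.log (f i) - ∑ j, s j * Real.log (g j) := by
  have hVW : (V ⊗ₖ W) * (V ⊗ₖ W)ᴴ = 1 := by
    rw [conjTranspose_kronecker, ← mul_kronecker_mul, hV', hW', one_kronecker_one]
  have h1 : ∑ j, ∑ i, ‖((V ⊗ₖ W)ᴴ * U) j i‖ ^ 2 * (p i * Real.log (p i))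
      = -(∑ i, Real.negMulLog (p i)) := by
    rw [Finset.sum_comm]
    simp only [← Finset.sum_mul, sum_norm_sq_col U _ hU hVW, one_mul, Real.negMulLog,
      ← Finset.sum_neg_distrib, neg_mul, neg_neg]
  have h2 : ∀ j : I × J, ∑ i, ‖((V ⊗ₖ W)ᴴ * U) j i‖ ^ 2 * (p i * Real.log (f j.1 * g j.2))
      = (((V ⊗ₖ W)ᴴ * conjDiag U p * (V ⊗ₖ W)) j j).re * Real.log (f j.1)
        + (((V ⊗ₖ W)ᴴ * conjDiag U p * (V ⊗ₖ W)) j j).re * Real.log (g j.2) := by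
    intro j
    rw [Real.log_mul (hf _).ne' (hg _).ne', ← mul_add, ← sum_norm_sq_mul, Finset.sum_mul]
    exact Finset.sum_congr rfl fun i _ => by ring
  have h3 : ∑ j : I × J, (((V ⊗ₖ W)ᴴ * conjDiag U p * (V ⊗ₖ W)) j j).re * Real.log (f j.1)
      = ∑ i, r i * Real.log (f i) := by
    rw [Fintype.sum_prod_type]
    refine Finset.sum_congr rfl fun i _ => ?_
    dsimp only
    rw [← Finset.sum_mul, ← Complex.re_sum, sum_kronecker_conj_apply_right _ _ _ hW', hr,
      conjTranspose_mul_conjDiag_mul V r hV]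
  have h4 : ∑ j : I × J, (((V ⊗ₖ W)ᴴ * conjDiag U p * (V ⊗ₖ W)) j j).re * Real.log (g j.2)
      = ∑ j, s j * Real.log (g j) := by
    rw [Fintype.sum_prod_type_right]
    refine Finset.sum_congr rfl fun i _ => ?_
    dsimp only
    rw [← Finset.sum_mul, ← Complex.re_sum, sum_kronecker_conj_apply_left _ _ _ hV', hs,
      conjTranspose_mul_conjDiag_mul W s hW]
  simp only [mul_sub, Finset.sum_sub_distrib, h1, h2, Finset.sum_add_distrib, h3, h4]
  ring

lemma tendsto_sum_mul_log_add {I : Type} [Fintype I] (r : I → ℝ) (hr : ∀ i, 0 ≤ r i) (c : ℝ) :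
    Tendsto (fun ε : ℝ => ∑ i, r i * Real.log (r i + ε * c)) (𝓝[>] 0)
      (𝓝 (-∑ i, Real.negMulLog (r i))) := by
  rw [← Finset.sum_neg_distrib]
  refine tendsto_finsetSum _ fun i _ => ?_
  simp only [Real.negMulLog, neg_mul, neg_neg]
  rcases (hr i).eq_or_lt with h | h
  · simp [← h]
  · refine Tendsto.const_mul _ (Tendsto.log ?_ h.ne')
    have : Tendsto (fun ε : ℝ => r i + ε * c) (𝓝 0) (𝓝 (r i + 0 * c)) :=
      (Continuous.tendsto (by fun_prop) 0)
    simpa using this.mono_left nhdsWithin_le_nhds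

/-- Mutual information does not increase when discarding a subsystem of each party. -/
theorem mutualInfo_ptrace_le {A A' B B' : Type} [Fintype A] [DecidableEq A] [Fintype A']
    [DecidableEq A'] [Fintype B] [DecidableEq B] [Fintype B'] [DecidableEq B']
    [Nonempty A'] [Nonempty B']
    {ρ : Matrix ((A × A') × (B × B')) ((A × A') × (B × B')) ℂ} (hρ : ρ.PosSemidef)
    {ρ₁ : Matrix (A × B) (A × B) ℂ}
    (hρ₁ : ρ₁ = ptrace (ρ.submatrix (Equiv.prodProdProdComm A B A' B')
      (Equiv.prodProdProdComm A B A' B'))) :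
    matEntropy (ptrace ρ₁) + matEntropy (ptraceLeft ρ₁) - matEntropy ρ₁
      ≤ matEntropy (ptrace ρ) + matEntropy (ptraceLeft ρ) - matEntropy ρ := by
  have psd₁ : ρ₁.PosSemidef := hρ₁ ▸ posSemidef_ptrace (hρ.submatrix _)
  obtain ⟨U, p, hU, hU', eU, hp, sU⟩ := exists_eq_conjDiag hρ
  obtain ⟨V, r, hV, hV', eV, hr, sV⟩ := exists_eq_conjDiag (posSemidef_ptrace hρ)
  obtain ⟨W, s, hW, hW', eW, hs, sW⟩ := exists_eq_conjDiag (posSemidef_ptraceLeft hρ)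
  obtain ⟨U₁, p₁, hU₁, hU₁', eU₁, hp₁, sU₁⟩ := exists_eq_conjDiag psd₁
  obtain ⟨V₁, r₁, hV₁, hV₁', eV₁, hr₁, sV₁⟩ := exists_eq_conjDiag (posSemidef_ptrace psd₁)
  obtain ⟨W₁, s₁, hW₁, hW₁', eW₁, hs₁, sW₁⟩ := exists_eq_conjDiag (posSemidef_ptraceLeft psd₁)
  have kron_unit : ∀ {P Q I J : Type} [Fintype P] [Fintype Q] [Fintype I] [Fintype J]
      [DecidableEq I] [DecidableEq J] (X : Matrix P I ℂ) (Y : Matrix Q J ℂ),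
      Xᴴ * X = 1 → Yᴴ * Y = 1 → (X ⊗ₖ Y)ᴴ * (X ⊗ₖ Y) = 1 := by
    intro P Q I J _ _ _ _ _ _ X Y hX hY
    rw [conjTranspose_kronecker, ← mul_kronecker_mul, hX, hY, one_kronecker_one]
  have kron_unit' : ∀ {P Q I J : Type} [Fintype P] [Fintype Q] [Fintype I] [Fintype J]
      [DecidableEq P] [DecidableEq Q] (X : Matrix P I ℂ) (Y : Matrix Q J ℂ),
      X * Xᴴ = 1 → Y * Yᴴ = 1 → (X ⊗ₖ Y) * (X ⊗ₖ Y)ᴴ = 1 := by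
    intro P Q I J _ _ _ _ _ _ X Y hX hY
    rw [conjTranspose_kronecker, ← mul_kronecker_mul, hX, hY, one_kronecker_one]
  set e := Equiv.prodProdProdComm A B A' B' with he
  have hcard : 0 < (Fintype.card A' : ℝ) := by exact_mod_cast Fintype.card_pos
  have hcard' : 0 < (Fintype.card B' : ℝ) := by exact_mod_cast Fintype.card_pos
  have hV₂ : ptrace (conjDiag V r) = conjDiag V₁ r₁ := by
    rw [← eV, ← eV₁, hρ₁]
    ext a a'
    simp only [ptrace, of_apply, submatrix_apply, he, Fintype.sum_prod_type,
      Equiv.prodProdProdComm_apply]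
    exact Finset.sum_comm
  have hW₂ : ptrace (conjDiag W s) = conjDiag W₁ s₁ := by
    rw [← eW, ← eW₁, hρ₁]
    ext a a'
    simp only [ptrace, ptraceLeft, of_apply, submatrix_apply, he, Fintype.sum_prod_type,
      Equiv.prodProdProdComm_apply]
    rw [Finset.sum_comm]
    exact Finset.sum_congr rfl fun _ _ => Finset.sum_comm
  have ptr_add : ∀ {K E : Type} [Fintype K] [DecidableEq K] [Fintype E] [DecidableEq E]
      (M : Matrix (K × E) (K × E) ℂ) (c : ℝ), ptrace (M + (c : ℂ) • 1)
        = ptrace M + ((c * Fintype.card E : ℝ) : ℂ) • 1 := by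
    intro K E _ _ _ _ M c
    ext k l
    by_cases h : k = l
    · subst h; simp [ptrace, Finset.sum_add_distrib, mul_comm]
    · simp [ptrace, h, Matrix.one_apply]
  have main : ∀ ε : ℝ, 0 < ε →
      -(∑ i, Real.negMulLog (p₁ i)) - ∑ i, r₁ i * Real.log (r₁ i + ε * Fintype.card A')
          - ∑ j, s₁ j * Real.log (s₁ j + ε * Fintype.card B')
        ≤ -(∑ i, Real.negMulLog (p i)) - ∑ i, r i * Real.log (r i + ε * 1)
          - ∑ j, s j * Real.log (s j + ε * 1) := by
    intro ε hε
    have f0 : ∀ i, 0 < r i + ε * 1 := fun i => by have := hr i; linarith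
    have g0 : ∀ i, 0 < s i + ε * 1 := fun i => by have := hs i; linarith
    have f₁0 : ∀ i, 0 < r₁ i + ε * Fintype.card A' := fun i =>
      add_pos_of_nonneg_of_pos (hr₁ i) (mul_pos hε hcard)
    have g₁0 : ∀ i, 0 < s₁ i + ε * Fintype.card B' := fun i =>
      add_pos_of_nonneg_of_pos (hs₁ i) (mul_pos hε hcard')
    rw [← relEntropy_kronecker_eq U p V r W s hU hV hV' hW hW' (eU ▸ eV) (eU ▸ eW) _ _ f0 g0,
      ← relEntropy_kronecker_eq U₁ p₁ V₁ r₁ W₁ s₁ hU₁ hV₁ hV₁' hW₁ hW₁' (eU₁ ▸ eV₁)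
        (eU₁ ▸ eW₁) _ _ f₁0 g₁0]
    have sub_unit : ∀ {I J : Type} (X : Matrix ((A × A') × (B × B')) I ℂ)
        (Y : Matrix ((A × A') × (B × B')) J ℂ),
        (X.submatrix e id)ᴴ * Y.submatrix e id = Xᴴ * Y := by
      intro I J X Y
      rw [conjTranspose_submatrix, submatrix_mul_equiv, submatrix_id_id]
    have sub_unit' : ∀ {I : Type} [Fintype I] (X : Matrix ((A × A') × (B × B')) I ℂ),
        X * Xᴴ = 1 → X.submatrix e id * (X.submatrix e id)ᴴ = 1 := by
      intro I _ X hX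
      have := submatrix_mul_equiv X Xᴴ e (Equiv.refl I) e
      rw [conjTranspose_submatrix]
      rw [hX, submatrix_one_equiv] at this
      exact this
    have hρ' : ptrace (conjDiag (U.submatrix e id) p) = conjDiag U₁ p₁ := by
      rw [conjDiag_submatrix, ← eU, ← eU₁, hρ₁]
    have hσ' : ptrace (conjDiag ((V ⊗ₖ W).submatrix e id)
        (fun ij => (r ij.1 + ε * 1) * (s ij.2 + ε * 1))) =
        conjDiag (V₁ ⊗ₖ W₁) (fun ij =>
          (r₁ ij.1 + ε * Fintype.card A') * (s₁ ij.2 + ε * Fintype.card B')) := by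
      have hk : ∀ (X : Matrix (A × A') (A × A') ℂ) (Y : Matrix (B × B') (B × B') ℂ),
          ptrace ((X ⊗ₖ Y).submatrix e e) = ptrace X ⊗ₖ ptrace Y := by
        intro X Y
        ext a b
        simp [ptrace, kroneckerMap_apply, Fintype.sum_prod_type, he, Finset.sum_mul_sum]
      rw [conjDiag_submatrix, ← conjDiag_kronecker V (fun i => r i + ε * 1) W
        (fun i => s i + ε * 1), ← conjDiag_kronecker V₁ (fun i => r₁ i + ε * Fintype.card A') W₁
        (fun i => s₁ i + ε * Fintype.card B'), hk, conjDiag_add_const _ _ hV',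
        conjDiag_add_const _ _ hW', conjDiag_add_const _ _ hV₁', conjDiag_add_const _ _ hW₁',
        ptr_add, ptr_add, hV₂, hW₂, mul_one]
    have hsum : ∑ i, p i = ∑ i, p₁ i := by
      have := trace_ptrace (conjDiag (U.submatrix e id) p)
      rw [hρ', trace_conjDiag _ _ hU₁, trace_conjDiag _ _ (by rw [sub_unit, hU])] at this
      exact_mod_cast this.symm
    have := relEntropy_ptrace_le (U.submatrix e id) p ((V ⊗ₖ W).submatrix e id)
      (fun ij => (r ij.1 + ε * 1) * (s ij.2 + ε * 1)) (by rw [sub_unit, hU]) (sub_unit' _ hU')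
      (by rw [sub_unit, kron_unit _ _ hV hW]) (sub_unit' _ (kron_unit' _ _ hV' hW'))
      U₁ p₁ (V₁ ⊗ₖ W₁)
      (fun ij => (r₁ ij.1 + ε * Fintype.card A') * (s₁ ij.2 + ε * Fintype.card B'))
      hU₁ (kron_unit _ _ hV₁ hW₁) (kron_unit' _ _ hV₁' hW₁') hp
      (fun ij => mul_pos (f0 _) (g0 _)) hp₁ (fun ij => mul_pos (f₁0 _) (g₁0 _)) hρ' hσ' hsum
    rw [sub_unit] at this
    exact this
  have lim := le_of_tendsto_of_tendsto
    ((tendsto_const_nhds.sub (tendsto_sum_mul_log_add r₁ hr₁ (Fintype.card A'))).sub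
      (tendsto_sum_mul_log_add s₁ hs₁ (Fintype.card B')))
    ((tendsto_const_nhds.sub (tendsto_sum_mul_log_add r hr 1)).sub
      (tendsto_sum_mul_log_add s hs 1))
    (eventually_nhdsWithin_of_forall fun ε hε => main ε hε)
  rw [sU, sV, sW, sU₁, sV₁, sW₁]
  linarith

end MutualInformation

section Reductions

open Matrix

lemma matEntropy_eq_roots_sum {n : Type} [Fintype n] [DecidableEq n] {M : Matrix n n ℂ}
    (hM : M.IsHermitian) :
    matEntropy M = (M.charpoly.roots.map fun z => Real.negMulLog z.re).sum := by
  rw [matEntropy, dif_pos hM, hM.roots_charpoly_eq_eigenvalues, Multiset.map_map]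
  rfl

lemma matEntropy_eq_of_charpoly {m n : Type} [Fintype m] [DecidableEq m] [Fintype n]
    [DecidableEq n] {M : Matrix m m ℂ} {N : Matrix n n ℂ} (hM : M.IsHermitian)
    (hN : N.IsHermitian) (a b : ℕ)
    (h : Polynomial.X ^ a * M.charpoly = Polynomial.X ^ b * N.charpoly) :
    matEntropy M = matEntropy N := by
  have key : ∀ (k : ℕ) (P : Polynomial ℂ), P ≠ 0 →
      ((Polynomial.X ^ k * P).roots.map fun z : ℂ => Real.negMulLog z.re).sum
        = (P.roots.map fun z : ℂ => Real.negMulLog z.re).sum := by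
    intro k P hP
    rw [Polynomial.roots_mul (mul_ne_zero (pow_ne_zero _ Polynomial.X_ne_zero) hP),
      Polynomial.roots_X_pow, Multiset.map_add, Multiset.sum_add, Multiset.map_nsmul,
      Multiset.sum_nsmul]
    simp
  rw [matEntropy_eq_roots_sum hM, matEntropy_eq_roots_sum hN,
    ← key a _ M.charpoly_monic.ne_zero, h, key b _ N.charpoly_monic.ne_zero]

lemma matEntropy_submatrix {m n : Type} [Fintype m] [DecidableEq m] [Fintype n]
    [DecidableEq n] (e : m ≃ n) (M : Matrix n n ℂ) :
    matEntropy (M.submatrix e e) = matEntropy M := by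
  by_cases hM : M.IsHermitian
  · refine matEntropy_eq_of_charpoly (hM.submatrix _) hM 0 0 ?_
    rw [← charpoly_reindex e.symm M]
    rfl
  · have : ¬ (M.submatrix e e).IsHermitian := by
      rwa [isHermitian_submatrix_equiv]
    rw [matEntropy, dif_neg this, matEntropy, dif_neg hM]

/-- The two marginals of a bipartite pure state have equal entropy. -/
lemma matEntropy_marginals_eq {P Q : Type} [Fintype P] [DecidableEq P] [Fintype Q]
    [DecidableEq Q] (Φ : P → Q → ℂ) :
    matEntropy (Matrix.of fun p p' => ∑ q, Φ p q * star (Φ p' q)) =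
      matEntropy (Matrix.of fun q q' => ∑ p, Φ p q * star (Φ p q')) := by
  have h1 : (Matrix.of fun p p' => ∑ q, Φ p q * star (Φ p' q))
      = Matrix.of Φ * (Matrix.of Φ)ᴴ := by
    ext p p'; simp [Matrix.mul_apply]
  have h2 : (Matrix.of fun q q' => ∑ p, Φ p q * star (Φ p q'))
      = ((Matrix.of Φ)ᴴ * Matrix.of Φ)ᵀ := by
    ext p p'; simp [Matrix.mul_apply, mul_comm]
  rw [h1, h2]
  refine matEntropy_eq_of_charpoly (isHermitian_mul_conjTranspose_self _)
    (isHermitian_conjTranspose_mul_self _).transpose (Fintype.card Q) (Fintype.card P) ?_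
  rw [charpoly_transpose]
  exact charpoly_mul_comm' _ _

/-- Entropy of a reduced matrix, computed in coordinates `E` that split the systems into
those in `s` and the others. -/
lemma matEntropy_reduce {κ : Type} [Fintype κ] [DecidableEq κ] {α : κ → Type}
    [∀ i, Fintype (α i)] [∀ i, DecidableEq (α i)] {P Q : Type} [Fintype P] [DecidableEq P]
    [Fintype Q] [Nonempty P] [Nonempty Q] (s : Finset κ)
    (ρ : Matrix (∀ i, α i) (∀ i, α i) ℂ) (E : P × Q ≃ ∀ i, α i)
    (hs : ∀ i ∈ s, ∀ p q q', E (p, q) i = E (p, q') i)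
    (hs' : ∀ i ∉ s, ∀ p p' q, E (p, q) i = E (p', q) i) :
    matEntropy (reduce s ρ)
      = matEntropy (Matrix.of fun p p' => ∑ q, ρ (E (p, q)) (E (p', q))) := by
  obtain ⟨p₀⟩ := ‹Nonempty P›
  obtain ⟨q₀⟩ := ‹Nonempty Q›
  let eP : (∀ i : {j // j ∈ s}, α i.1) ≃ P :=
    { toFun := fun f => (E.symm fun i => if hi : i ∈ s then f ⟨i, hi⟩ else E (p₀, q₀) i).1
      invFun := fun p i => E (p, q₀) i
      left_inv := fun f => by
        funext i
        dsimp only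
        rw [hs i.1 i.2 _ q₀ (E.symm fun i => if hi : i ∈ s then f ⟨i, hi⟩ else E (p₀, q₀) i).2,
          Prod.mk.eta, E.apply_symm_apply, dif_pos i.2]
      right_inv := fun p => by
        have : (fun i => if hi : i ∈ s then E (p, q₀) i else E (p₀, q₀) i) = E (p, q₀) := by
          funext i
          split_ifs with hi
          · rfl
          · exact hs' i hi _ _ _
        simp only [this, E.symm_apply_apply] }
  let eQ : (∀ i : {j // j ∉ s}, α i.1) ≃ Q :=
    { toFun := fun f => (E.symm fun i => if hi : i ∈ s then E (p₀, q₀) i else f ⟨i, hi⟩).2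
      invFun := fun q i => E (p₀, q) i
      left_inv := fun f => by
        funext i
        dsimp only
        rw [hs' i.1 i.2 p₀ (E.symm fun i => if hi : i ∈ s then E (p₀, q₀) i else f ⟨i, hi⟩).1,
          Prod.mk.eta, E.apply_symm_apply, dif_neg i.2]
      right_inv := fun q => by
        have : (fun i => if hi : i ∈ s then E (p₀, q₀) i else E (p₀, q) i) = E (p₀, q) := by
          funext i
          split_ifs with hi
          · exact hs i hi _ _ _
          · rfl
        simp only [this, E.symm_apply_apply] }
  have hm : ∀ f h, E (eP f, eQ h) = fun i => if hi : i ∈ s then f ⟨i, hi⟩ else h ⟨i, hi⟩ := by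
    intro f h
    funext i
    split_ifs with hi
    · rw [hs i hi _ _ q₀]
      exact congrFun (eP.left_inv f) ⟨i, hi⟩
    · rw [hs' i hi _ p₀]
      exact congrFun (eQ.left_inv h) ⟨i, hi⟩
  rw [← matEntropy_submatrix eP]
  congr 1
  ext f g
  simp only [reduce, of_apply, submatrix_apply]
  refine Fintype.sum_equiv eQ _ _ fun h => ?_
  rw [hm, hm]

/-- A tripartite pure state has `I(AA':BB') = S_{AA'} + S_{BB'} - S_{CC'}`, which bounds `I(A:B)`. -/
lemma mutualInfo_le_of_pure {A A' B B' T : Type} [Fintype A] [DecidableEq A] [Fintype A']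
    [DecidableEq A'] [Fintype B] [DecidableEq B] [Fintype B'] [DecidableEq B']
    [Fintype T] [DecidableEq T] [Nonempty A'] [Nonempty B']
    (Φ : A × A' → B × B' → T → ℂ) (ρ : Matrix (A × B) (A × B) ℂ)
    (hρ : ∀ a b a₂ b₂, ρ (a, b) (a₂, b₂) =
      ∑ a', ∑ b', ∑ t, Φ (a, a') (b, b') t * star (Φ (a₂, a') (b₂, b') t)) :
    matEntropy (ptrace ρ) + matEntropy (ptraceLeft ρ) - matEntropy ρ ≤
      matEntropy (Matrix.of fun x x' => ∑ y, ∑ t, Φ x y t * star (Φ x' y t))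
      + matEntropy (Matrix.of fun y y' => ∑ x, ∑ t, Φ x y t * star (Φ x y' t))
      - matEntropy (Matrix.of fun t t' => ∑ x, ∑ y, Φ x y t * star (Φ x y t')) := by
  have h := mutualInfo_ptrace_le (ρ₁ := ρ)
    (posSemidef_self_mul_conjTranspose
      (Matrix.of fun (x : (A × A') × (B × B')) t => Φ x.1 x.2 t)) (by
      ext ⟨a, b⟩ ⟨a₂, b₂⟩
      simp [hρ, ptrace, Matrix.mul_apply, Fintype.sum_prod_type])
  have h3 := matEntropy_marginals_eq (fun (x : (A × A') × (B × B')) t => Φ x.1 x.2 t)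
  simp only [Fintype.sum_prod_type (f := fun x : (A × A') × (B × B') => _)] at h3
  rw [← h3]
  have e : (Matrix.of fun (x : (A × A') × (B × B')) t => Φ x.1 x.2 t) *
      (Matrix.of fun (x : (A × A') × (B × B')) t => Φ x.1 x.2 t)ᴴ =
      Matrix.of fun x x' => ∑ t, Φ x.1 x.2 t * star (Φ x'.1 x'.2 t) := by
    ext x x'; simp [Matrix.mul_apply]
  rw [e] at h
  exact h

end Reductions

section Coordinates

open Matrix

/-- Assignment on three systems from its values. -/
def tri {α : Fin 3 → Type} (a : α 0) (b : α 1) (c : α 2) : ∀ i, α i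
  | 0 => a
  | 1 => b
  | 2 => c

lemma tri_eta {α : Fin 3 → Type} (f : ∀ i, α i) : tri (f 0) (f 1) (f 2) = f := by
  funext i; fin_cases i <;> rfl

/-- Assignments on three systems as triples. -/
def triEquiv (α : Fin 3 → Type) : α 0 × α 1 × α 2 ≃ ∀ i, α i where
  toFun x := tri x.1 x.2.1 x.2.2
  invFun f := (f 0, f 1, f 2)
  left_inv _ := rfl
  right_inv f := tri_eta f

/-- Assignments on three systems and their ancillas, grouped by party. -/
def partyEquiv (α δ : Fin 3 → Type) :
    (α 0 × δ 0) × (α 1 × δ 1) × (α 2 × δ 2) ≃ ∀ i : Fin 3 ⊕ Fin 3, Sum.elim α δ i where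
  toFun x := mergeSum (tri x.1.1 x.2.1.1 x.2.2.1) (tri x.1.2 x.2.1.2 x.2.2.2)
  invFun f := ((f (.inl 0), f (.inr 0)), (f (.inl 1), f (.inr 1)), (f (.inl 2), f (.inr 2)))
  left_inv _ := rfl
  right_inv f := by
    funext i; rcases i with i | i <;> fin_cases i <;> rfl

/-- `(y, x, z) ↦ (x, y, z)`. -/
def swapFirst (X Y Z : Type) : Y × X × Z ≃ X × Y × Z where
  toFun t := (t.2.1, t.1, t.2.2)
  invFun t := (t.2.1, t.1, t.2.2)
  left_inv _ := rfl
  right_inv _ := rfl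

/-- `(z, x, y) ↦ (x, y, z)`. -/
def rotateFirst (X Y Z : Type) : Z × X × Y ≃ X × Y × Z where
  toFun t := (t.2.1, t.2.2, t.1)
  invFun t := (t.2.2, t.1, t.2.1)
  left_inv _ := rfl
  right_inv _ := rfl

/-- `((x, z), y) ↦ (x, y, z)`. -/
def insertMiddle (X Y Z : Type) : (X × Z) × Y ≃ X × Y × Z where
  toFun t := (t.1.1, t.2, t.1.2)
  invFun t := ((t.1, t.2.2), t.2.1)
  left_inv _ := rfl
  right_inv _ := rfl

section Marginals

variable {α : Fin 3 → Type} [∀ i, Fintype (α i)] [∀ i, DecidableEq (α i)] [∀ i, Nonempty (α i)]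
  (ρ : Matrix (∀ i, α i) (∀ i, α i) ℂ)

lemma matEntropy_reduce_zero : matEntropy (reduce {0} ρ) =
    matEntropy (Matrix.of fun a a' => ∑ b, ∑ c, ρ (tri a b c) (tri a' b c)) := by
  rw [matEntropy_reduce {0} ρ (triEquiv α)
    (by intro i hi; fin_cases i <;> first | (exact absurd hi (by decide)) | (intros; rfl))
    (by intro i hi; fin_cases i <;> first | (exact absurd hi (by decide)) | (intros; rfl))]
  simp only [Fintype.sum_prod_type]
  rfl

lemma matEntropy_reduce_one : matEntropy (reduce {1} ρ) =
    matEntropy (Matrix.of fun b b' => ∑ a, ∑ c, ρ (tri a b c) (tri a b' c)) := by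
  rw [matEntropy_reduce {1} ρ ((swapFirst _ _ _).trans (triEquiv α))
    (by intro i hi; fin_cases i <;> first | (exact absurd hi (by decide)) | (intros; rfl))
    (by intro i hi; fin_cases i <;> first | (exact absurd hi (by decide)) | (intros; rfl))]
  simp only [Fintype.sum_prod_type]
  rfl

lemma matEntropy_reduce_two : matEntropy (reduce {2} ρ) =
    matEntropy (Matrix.of fun c c' => ∑ a, ∑ b, ρ (tri a b c) (tri a b c')) := by
  rw [matEntropy_reduce {2} ρ ((rotateFirst _ _ _).trans (triEquiv α))
    (by intro i hi; fin_cases i <;> first | (exact absurd hi (by decide)) | (intros; rfl))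
    (by intro i hi; fin_cases i <;> first | (exact absurd hi (by decide)) | (intros; rfl))]
  simp only [Fintype.sum_prod_type]
  rfl

lemma matEntropy_reduce_zero_one : matEntropy (reduce {0, 1} ρ) =
    matEntropy (Matrix.of fun (x x' : α 0 × α 1) =>
      ∑ c, ρ (tri x.1 x.2 c) (tri x'.1 x'.2 c)) := by
  rw [matEntropy_reduce {0, 1} ρ ((Equiv.prodAssoc _ _ _).trans (triEquiv α))
    (by intro i hi; fin_cases i <;> first | (exact absurd hi (by decide)) | (intros; rfl))
    (by intro i hi; fin_cases i <;> first | (exact absurd hi (by decide)) | (intros; rfl))]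
  rfl

lemma matEntropy_reduce_one_two : matEntropy (reduce {1, 2} ρ) =
    matEntropy (Matrix.of fun (x x' : α 1 × α 2) =>
      ∑ a, ρ (tri a x.1 x.2) (tri a x'.1 x'.2)) := by
  rw [matEntropy_reduce {1, 2} ρ ((Equiv.prodComm _ _).trans (triEquiv α))
    (by intro i hi; fin_cases i <;> first | (exact absurd hi (by decide)) | (intros; rfl))
    (by intro i hi; fin_cases i <;> first | (exact absurd hi (by decide)) | (intros; rfl))]
  rfl

lemma matEntropy_reduce_zero_two : matEntropy (reduce {0, 2} ρ) =
    matEntropy (Matrix.of fun (x x' : α 0 × α 2) =>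
      ∑ b, ρ (tri x.1 b x.2) (tri x'.1 b x'.2)) := by
  rw [matEntropy_reduce {0, 2} ρ ((insertMiddle _ _ _).trans (triEquiv α))
    (by intro i hi; fin_cases i <;> first | (exact absurd hi (by decide)) | (intros; rfl))
    (by intro i hi; fin_cases i <;> first | (exact absurd hi (by decide)) | (intros; rfl))]
  rfl

end Marginals

section Parties

variable {α : Fin 3 → Type} [∀ i, Fintype (α i)] [∀ i, DecidableEq (α i)] [∀ i, Nonempty (α i)]
  {d : Fin 3 → ℕ} [∀ i, Nonempty (Fin (d i))]
  (ψ : (∀ i : Fin 3 ⊕ Fin 3, Sum.elim α (fun k => Fin (d k)) i) → ℂ)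

/-- Amplitudes of a purification, as a function of the three parties. -/
def partyAmp (x : α 0 × Fin (d 0)) (y : α 1 × Fin (d 1)) (z : α 2 × Fin (d 2)) : ℂ :=
  ψ (mergeSum (tri x.1 y.1 z.1) (tri (α := fun k => Fin (d k)) x.2 y.2 z.2))

lemma matEntropy_reduce_party_zero :
    matEntropy (reduce (partyFinset id 0) (vecState ψ)) =
      matEntropy (Matrix.of fun x x' => ∑ y, ∑ z, partyAmp ψ x y z * star (partyAmp ψ x' y z)) := by
  rw [matEntropy_reduce _ (vecState ψ) (partyEquiv α (fun k => Fin (d k)))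
    (by intro i hi; rcases i with i | i <;> fin_cases i <;>
          first | (exact absurd hi (by decide)) | (intros; rfl))
    (by intro i hi; rcases i with i | i <;> fin_cases i <;>
          first | (exact absurd hi (by decide)) | (intros; rfl))]
  simp only [Fintype.sum_prod_type (f := fun x : (α 1 × Fin (d 1)) × (α 2 × Fin (d 2)) => _)]
  rfl

lemma matEntropy_reduce_party_one :
    matEntropy (reduce (partyFinset id 1) (vecState ψ)) =
      matEntropy (Matrix.of fun y y' => ∑ x, ∑ z, partyAmp ψ x y z * star (partyAmp ψ x y' z)) := by
  rw [matEntropy_reduce _ (vecState ψ)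
    ((swapFirst _ _ _).trans (partyEquiv α (fun k => Fin (d k))))
    (by intro i hi; rcases i with i | i <;> fin_cases i <;>
          first | (exact absurd hi (by decide)) | (intros; rfl))
    (by intro i hi; rcases i with i | i <;> fin_cases i <;>
          first | (exact absurd hi (by decide)) | (intros; rfl))]
  simp only [Fintype.sum_prod_type (f := fun x : (α 0 × Fin (d 0)) × (α 2 × Fin (d 2)) => _)]
  rfl

lemma matEntropy_reduce_party_two :
    matEntropy (reduce (partyFinset id 2) (vecState ψ)) =
      matEntropy (Matrix.of fun z z' => ∑ x, ∑ y, partyAmp ψ x y z * star (partyAmp ψ x y z')) := by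
  rw [matEntropy_reduce _ (vecState ψ)
    ((rotateFirst _ _ _).trans (partyEquiv α (fun k => Fin (d k))))
    (by intro i hi; rcases i with i | i <;> fin_cases i <;>
          first | (exact absurd hi (by decide)) | (intros; rfl))
    (by intro i hi; rcases i with i | i <;> fin_cases i <;>
          first | (exact absurd hi (by decide)) | (intros; rfl))]
  simp only [Fintype.sum_prod_type (f := fun x : (α 0 × Fin (d 0)) × (α 1 × Fin (d 1)) => _)]
  rfl

omit [∀ i, DecidableEq (α i)] [∀ i, Nonempty (α i)] [∀ i, Nonempty (Fin (d i))] in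
lemma Purifies.sum_partyAmp {ψ : (∀ i : Fin 3 ⊕ Fin 3, Sum.elim α (fun k => Fin (d k)) i) → ℂ}
    {ρ : Matrix (∀ i, α i) (∀ i, α i) ℂ} (h : Purifies ψ ρ) (a a₂ : α 0) (b b₂ : α 1)
    (c c₂ : α 2) :
    ρ (tri a b c) (tri a₂ b₂ c₂) = ∑ a', ∑ b', ∑ c',
      partyAmp ψ (a, a') (b, b') (c, c') * star (partyAmp ψ (a₂, a') (b₂, b') (c₂, c')) := by
  rw [← h, ← (triEquiv fun k => Fin (d k)).sum_comp]
  simp only [Fintype.sum_prod_type]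
  rfl

end Parties

end Coordinates

section EntanglementOfPurification

open Matrix

variable {α : Fin 3 → Type} [∀ i, Fintype (α i)] [∀ i, DecidableEq (α i)]
  {ρ : Matrix (∀ i, α i) (∀ i, α i) ℂ}

lemma of_sum_comm {n Y Z : Type} [Fintype Y] [Fintype Z] (f : Y → Z → n → n → ℂ) :
    (Matrix.of fun x x' => ∑ y, ∑ z, f y z x x') = Matrix.of fun x x' => ∑ z, ∑ y, f y z x x' := by
  ext x x'
  exact Finset.sum_comm

lemma exists_eq_mul_conjTranspose {n : Type} [Fintype n] [DecidableEq n] {M : Matrix n n ℂ}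
    (hM : M.PosSemidef) : ∃ F : Matrix n n ℂ, M = F * Fᴴ := by
  obtain ⟨U, p, -, -, hU, hp, -⟩ := exists_eq_conjDiag hM
  refine ⟨U * diagonal fun i => ((√(p i) : ℝ) : ℂ), ?_⟩
  have h : (diagonal fun i => ((√(p i) : ℝ) : ℂ)) * (diagonal fun i => ((√(p i) : ℝ) : ℂ))ᴴ
      = diagonal fun i => (p i : ℂ) := by
    rw [diagonal_conjTranspose, diagonal_mul_diagonal]
    congr 1
    funext i
    simp only [Pi.star_apply, Complex.star_def, Complex.conj_ofReal, ← Complex.ofReal_mul,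
      Real.mul_self_sqrt (hp i)]
  rw [hU, conjDiag, ← h, conjTranspose_mul]
  simp only [Matrix.mul_assoc]

omit [∀ i, DecidableEq (α i)] in
lemma IsDensityMatrix.nonempty (hρ : IsDensityMatrix ρ) (i : Fin 3) : Nonempty (α i) := by
  by_contra h
  rw [not_nonempty_iff] at h
  have : IsEmpty (∀ i, α i) := isEmpty_pi.2 ⟨i, h⟩
  simpa [Matrix.trace] using hρ.2

omit [∀ i, DecidableEq (α i)] in
lemma Purifies.nonempty_ancilla (hρ : IsDensityMatrix ρ) {d : Fin 3 → ℕ}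
    {ψ : (∀ i : Fin 3 ⊕ Fin 3, Sum.elim α (fun k => Fin (d k)) i) → ℂ} (h : Purifies ψ ρ)
    (i : Fin 3) : Nonempty (Fin (d i)) := by
  by_contra hi
  rw [not_nonempty_iff] at hi
  have : IsEmpty (∀ k, Fin (d k)) := isEmpty_pi.2 ⟨i, hi⟩
  have h0 : ρ = 0 := by
    ext f g
    rw [← h f g, Finset.univ_eq_empty, Finset.sum_empty, Matrix.zero_apply]
  have := hρ.2
  simp [h0] at this

/-- Every purification satisfies
`S_{AA'} + S_{BB'} + S_{CC'} ≥ 2(S_A + S_B + S_C) - S_{AB} - S_{BC} - S_{AC}`. -/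
lemma Purifies.le_sum_matEntropy (hρ : IsDensityMatrix ρ) {d : Fin 3 → ℕ}
    {ψ : (∀ i : Fin 3 ⊕ Fin 3, Sum.elim α (fun k => Fin (d k)) i) → ℂ} (h : Purifies ψ ρ) :
    2 * (matEntropy (reduce {0} ρ) + matEntropy (reduce {1} ρ) + matEntropy (reduce {2} ρ))
      - matEntropy (reduce ({0, 1} : Finset (Fin 3)) ρ)
      - matEntropy (reduce ({1, 2} : Finset (Fin 3)) ρ)
      - matEntropy (reduce ({0, 2} : Finset (Fin 3)) ρ)
      ≤ ∑ k : Fin 3, matEntropy (reduce (partyFinset id k) (vecState ψ)) := by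
  have := hρ.nonempty
  have := h.nonempty_ancilla hρ
  rw [Fin.sum_univ_three, matEntropy_reduce_party_zero, matEntropy_reduce_party_one,
    matEntropy_reduce_party_two, matEntropy_reduce_zero, matEntropy_reduce_one,
    matEntropy_reduce_two, matEntropy_reduce_zero_one, matEntropy_reduce_one_two,
    matEntropy_reduce_zero_two]
  have h01 := mutualInfo_le_of_pure (fun x y z => partyAmp ψ x y z)
    (Matrix.of fun (x x' : α 0 × α 1) => ∑ c, ρ (tri x.1 x.2 c) (tri x'.1 x'.2 c)) (by
      intro a b a₂ b₂
      simp only [of_apply, h.sum_partyAmp, Fintype.sum_prod_type]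
      rw [Finset.sum_comm]
      refine Finset.sum_congr rfl fun a' _ => ?_
      rw [Finset.sum_comm])
  have h12 := mutualInfo_le_of_pure (fun y z x => partyAmp ψ x y z)
    (Matrix.of fun (x x' : α 1 × α 2) => ∑ a, ρ (tri a x.1 x.2) (tri a x'.1 x'.2)) (by
      intro b c b₂ c₂
      simp only [of_apply, h.sum_partyAmp, Fintype.sum_prod_type]
      symm
      rw [Finset.sum_comm_cycle]
      exact Finset.sum_congr rfl fun a _ => Finset.sum_comm_cycle)
  have h02 := mutualInfo_le_of_pure (fun x z y => partyAmp ψ x y z)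
    (Matrix.of fun (x x' : α 0 × α 2) => ∑ b, ρ (tri x.1 b x.2) (tri x'.1 b x'.2)) (by
      intro a c a₂ c₂
      simp only [of_apply, h.sum_partyAmp, Fintype.sum_prod_type]
      rw [Finset.sum_comm]
      refine Finset.sum_congr rfl fun a' _ => ?_
      rw [Finset.sum_comm_cycle])
  simp only [ptrace, ptraceLeft, of_apply] at h01 h12 h02
  rw [of_sum_comm (fun z x y y' => partyAmp ψ x y z * star (partyAmp ψ x y' z)),
    of_sum_comm (fun y x z z' => partyAmp ψ x y z * star (partyAmp ψ x y z')),
    of_sum_comm (fun c a b b' => ρ (tri a b c) (tri a b' c)),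
    of_sum_comm (fun b a c c' => ρ (tri a b c) (tri a b c'))] at h12
  rw [of_sum_comm (fun z y x x' => partyAmp ψ x y z * star (partyAmp ψ x' y z)),
    of_sum_comm (fun c b a a' => ρ (tri a b c) (tri a' b c))] at h02
  linarith

/-- The square-root purification, with the whole purifying system given to the third party. -/
lemma exists_purifies_sum_eq (hρ : IsDensityMatrix ρ) :
    ∃ (d : Fin 3 → ℕ) (ψ : (∀ i : Fin 3 ⊕ Fin 3, Sum.elim α (fun k => Fin (d k)) i) → ℂ),
      Purifies ψ ρ ∧ matEntropy (reduce {0} ρ) + matEntropy (reduce {1} ρ)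
        + matEntropy (reduce ({0, 1} : Finset (Fin 3)) ρ)
        = ∑ k : Fin 3, matEntropy (reduce (partyFinset id k) (vecState ψ)) := by
  have := hρ.nonempty
  obtain ⟨F, hF⟩ := exists_eq_mul_conjTranspose hρ.1
  let e := Fintype.equivFin (∀ i, α i)
  let d : Fin 3 → ℕ := ![1, 1, Fintype.card (∀ i, α i)]
  let ψ : (∀ i : Fin 3 ⊕ Fin 3, Sum.elim α (fun k => Fin (d k)) i) → ℂ :=
    fun x => F (fun i => x (.inl i)) (e.symm (x (.inr 2)))
  have hd0 : d 0 = 1 := rfl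
  have hd1 : d 1 = 1 := rfl
  let _ : Unique (Fin (d 0)) := (finCongr hd0).unique
  let _ : Unique (Fin (d 1)) := (finCongr hd1).unique
  have hF' : ∀ f g, ∑ c' : Fin (d 2), F f (e.symm c') * star (F g (e.symm c')) = ρ f g := by
    intro f g
    rw [hF, Matrix.mul_apply]
    exact Equiv.sum_comp e.symm fun k => F f k * star (F g k)
  have hψ : Purifies ψ ρ := by
    intro f g
    rw [← (triEquiv fun k => Fin (d k)).sum_comp]
    simp only [Fintype.sum_prod_type, Fintype.sum_unique]
    exact hF' f g
  have := hψ.nonempty_ancilla hρ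
  have hamp : ∀ x y z, partyAmp ψ x y z = F (tri x.1 y.1 z.1) (e.symm z.2) := fun _ _ _ => rfl
  refine ⟨d, ψ, hψ, ?_⟩
  rw [Fin.sum_univ_three, matEntropy_reduce_party_zero, matEntropy_reduce_party_one,
    matEntropy_reduce_party_two, matEntropy_reduce_zero, matEntropy_reduce_one,
    matEntropy_reduce_zero_one]
  have hC := matEntropy_marginals_eq
    (fun (x : (α 0 × Fin (d 0)) × (α 1 × Fin (d 1))) z => partyAmp ψ x.1 x.2 z)
  simp only [Fintype.sum_prod_type
    (f := fun x : (α 0 × Fin (d 0)) × (α 1 × Fin (d 1)) => _)] at hC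
  rw [← hC, ← matEntropy_submatrix (Equiv.prodUnique (α 0) (Fin (d 0))),
    ← matEntropy_submatrix (Equiv.prodUnique (α 1) (Fin (d 1))),
    ← matEntropy_submatrix ((Equiv.prodUnique (α 0) (Fin (d 0))).prodCongr
      (Equiv.prodUnique (α 1) (Fin (d 1))))]
  congr 2
  · congr 1
    ext x x'
    simp [hamp, ← hF', Fintype.sum_prod_type]
  · congr 1
    ext x x'
    simp [hamp, ← hF', Fintype.sum_prod_type]
  · ext x x'
    simp [hamp, ← hF', Fintype.sum_prod_type]

end EntanglementOfPurification

/-- if a tripartite state saturates both strong subadditivity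
inequalities `S_A + S_C = S_{AB} + S_{BC}` and `S_B + S_C = S_{AB} + S_{AC}`,
then `Δ_P(A:B:C) = S_A + S_B + S_{AB}`.
Subsystems `A, B, C` are indexed by `0, 1, 2 : Fin 3`. -/
theorem DeltaP_of_saturated_SSA {α : Fin 3 → Type}
    [∀ i, Fintype (α i)] [∀ i, DecidableEq (α i)]
    (ρ : Matrix (∀ i, α i) (∀ i, α i) ℂ) (hρ : IsDensityMatrix ρ)
    (hsat1 : matEntropy (reduce {0} ρ) + matEntropy (reduce {2} ρ)
      = matEntropy (reduce ({0, 1} : Finset (Fin 3)) ρ)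
        + matEntropy (reduce ({1, 2} : Finset (Fin 3)) ρ))
    (hsat2 : matEntropy (reduce {1} ρ) + matEntropy (reduce {2} ρ)
      = matEntropy (reduce ({0, 1} : Finset (Fin 3)) ρ)
        + matEntropy (reduce ({0, 2} : Finset (Fin 3)) ρ)) :
    DeltaPart id ρ = matEntropy (reduce {0} ρ) + matEntropy (reduce {1} ρ)
      + matEntropy (reduce ({0, 1} : Finset (Fin 3)) ρ) := by
  refine IsLeast.csInf_eq ⟨exists_purifies_sum_eq hρ, ?_⟩
  rintro x ⟨d, ψ, hψ, rfl⟩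
  have := hψ.le_sum_matEntropy hρ
  linarith
end
end
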